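/- For every κ ∈ ℝ there exist constants c, c₃, C₁ > 0 depending only on κ such that for all sufficiently large N: ℙ_p(⋂_{x : ω_x = 1} H(x) = ∅) ≤ e^{-cN} when p = c₃ N 2^{-N}, and ℙ_p(⋂_{x : ω_x = 1} H(x) = ∅) ≥ 1 − e^{-cN} when p = C₁ N 2^{-N}. -/

import Mathlib

open scoped Classical

noncomputable section


/-- A point of the discrete cube `Σ_N = {-1,1}^N`, encoded by booleans
(`true ↦ +1`, `false ↦ -1`). -/
abbrev Cube (N : ℕ) := Fin N → Bool

/-- The `±1` value encoded by a boolean. -/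
def pmVal (b : Bool) : ℝ := if b then 1 else -1

/-- The inner product `x · y = ∑ i x^i y^i` on `Σ_N`. -/
def cubeDot {N : ℕ} (x y : Cube N) : ℝ := ∑ i, pmVal (x i) * pmVal (y i)

/-- The half cube `H(x) := {y ∈ Σ_N : x · y ≥ κ √N}`. -/
def halfCube {N : ℕ} (κ : ℝ) (x : Cube N) : Set (Cube N) :=
  {y | cubeDot x y ≥ κ * Real.sqrt N}

/-- Bernoulli(p) product weight of a configuration `ω : Σ_N → {0,1}`. -/
def bWeight {N : ℕ} (p : ℝ) (ω : Cube N → Bool) : ℝ :=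
  p ^ (Finset.univ.filter fun x => ω x = true).card *
    (1 - p) ^ (Finset.univ.filter fun x => ω x = false).card

/-- The product Bernoulli measure `ℙ_p` of an event `E ⊆ {0,1}^{Σ_N}`. -/
def bernoulliP {N : ℕ} (p : ℝ) (E : Set (Cube N → Bool)) : ℝ :=
  ∑ ω : Cube N → Bool, if ω ∈ E then bWeight p ω else 0

/-- The event `E = {⋂_{x : ω_x = 1} H(x) = ∅}`. -/
def emptyInter {N : ℕ} (κ : ℝ) : Set (Cube N → Bool) :=
  {ω | (⋂ x ∈ {x : Cube N | ω x = true}, halfCube κ x) = (∅ : Set (Cube N))}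


lemma pmVal_true : pmVal true = 1 := by simp [pmVal]
lemma pmVal_false : pmVal false = -1 := by simp [pmVal]
lemma pmVal_sq (b : Bool) : pmVal b * pmVal b = 1 := by cases b <;> simp [pmVal]
lemma pmVal_abs (b : Bool) : |pmVal b| = 1 := by cases b <;> simp [pmVal]

def lin {n : ℕ} (c : Fin n → ℝ) (χ : Fin n → Bool) : ℝ := ∑ i, c i * pmVal (χ i)

lemma sum_cons_cube (n : ℕ) (f : (Fin (n+1) → Bool) → ℝ) :
    ∑ χ, f χ = ∑ χ : Fin n → Bool, (f (Fin.cons true χ) + f (Fin.cons false χ)) := by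
  rw [← (Fin.consEquiv (fun _ : Fin (n+1) => Bool)).sum_comp, Fintype.sum_prod_type,
    Fintype.sum_bool, ← Finset.sum_add_distrib]
  rfl

lemma lin_cons_true {n : ℕ} (c : Fin (n+1) → ℝ) (χ : Fin n → Bool) :
    lin c (Fin.cons true χ) = lin (fun i => c i.succ) χ + c 0 := by
  simp [lin, Fin.sum_univ_succ, pmVal_true]; ring

lemma lin_cons_false {n : ℕ} (c : Fin (n+1) → ℝ) (χ : Fin n → Bool) :
    lin c (Fin.cons false χ) = lin (fun i => c i.succ) χ - c 0 := by
  simp [lin, Fin.sum_univ_succ, pmVal_false]; ring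

lemma mom2 (n : ℕ) (c : Fin n → ℝ) : ∑ χ, (lin c χ)^2 = 2^n * ∑ i, (c i)^2 := by
  induction n with
  | zero => simp [lin]
  | succ n ih =>
    rw [sum_cons_cube]
    have : ∀ χ : Fin n → Bool, (lin c (Fin.cons true χ))^2 + (lin c (Fin.cons false χ))^2
        = 2 * (lin (fun i => c i.succ) χ)^2 + 2 * (c 0)^2 := by
      intro χ; rw [lin_cons_true, lin_cons_false]; ring
    simp only [this]
    rw [Finset.sum_add_distrib, ← Finset.mul_sum, ih, Fin.sum_univ_succ]
    simp
    ring

lemma mom4 (n : ℕ) (c : Fin n → ℝ) : ∑ χ, (lin c χ)^4 ≤ 2^n * (3 * (∑ i, (c i)^2)^2) := by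
  induction n with
  | zero => simp [lin]
  | succ n ih =>
    rw [sum_cons_cube]
    have : ∀ χ : Fin n → Bool, (lin c (Fin.cons true χ))^4 + (lin c (Fin.cons false χ))^4
        = 2 * (lin (fun i => c i.succ) χ)^4 + 12 * (c 0)^2 * (lin (fun i => c i.succ) χ)^2
          + 2 * (c 0)^4 := by
      intro χ; rw [lin_cons_true, lin_cons_false]; ring
    simp only [this]
    rw [Finset.sum_add_distrib, Finset.sum_add_distrib, ← Finset.mul_sum, ← Finset.mul_sum,
      mom2, Fin.sum_univ_succ]
    have h := ih (fun i => c i.succ)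
    simp only [Finset.sum_const, Finset.card_univ, Fintype.card_pi, Fintype.card_bool,
      Finset.prod_const, Fintype.card_fin, nsmul_eq_mul]
    push_cast
    set T := ∑ i : Fin n, (c i.succ)^2
    have h2 : (0:ℝ) ≤ 2^n * (c 0)^4 := by positivity
    rw [pow_succ (2:ℝ)]
    nlinarith

lemma expsq (n : ℕ) : ∀ (D : ℝ) (_ : 2 * (n:ℝ) < D) (c : Fin n → ℝ) (_ : ∀ i, (c i)^2 = 1),
    ∑ χ, Real.exp ((lin c χ)^2 / D) ≤ 2^n * Real.exp (n / (D - 2*n)) := by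
  induction n with
  | zero => intro D hD c hc; simp [lin]
  | succ n ih =>
    intro D hD c hc
    push_cast at hD
    have hn : (0:ℝ) ≤ n := Nat.cast_nonneg n
    have hD2 : 2 < D := by linarith
    rw [sum_cons_cube]
    have key : ∀ χ : Fin n → Bool, Real.exp ((lin c (Fin.cons true χ))^2/D)
        + Real.exp ((lin c (Fin.cons false χ))^2/D)
        ≤ 2 * Real.exp (1/D) * Real.exp ((lin (fun i => c i.succ) χ)^2/(D-2)) := by
      intro χ; rw [lin_cons_true, lin_cons_false]
      set v := lin (fun i => c i.succ) χ
      have e1 : (v + c 0)^2/D = (v^2+1)/D + 2*v*c 0/D := by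
        rw [← hc 0]; ring
      have e2 : (v - c 0)^2/D = (v^2+1)/D + -(2*v*c 0/D) := by
        rw [← hc 0]; ring
      rw [e1, e2, Real.exp_add, Real.exp_add, ← mul_add]
      have h3 := Real.cosh_le_exp_half_sq (2*v*c 0/D)
      rw [Real.cosh_eq] at h3
      have h4 : (2*v*c 0/D)^2/2 = 2*v^2/D^2 := by
        have : (2*v*c 0/D)^2/2 = 2*v^2*(c 0)^2/D^2 := by ring
        rw [this, hc 0]; ring
      rw [h4] at h3
      calc _ ≤ Real.exp ((v^2+1)/D) * (2 * Real.exp (2*v^2/D^2)) := by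
            gcongr; linarith
        _ = 2 * Real.exp (1/D) * Real.exp (v^2/D + 2*v^2/D^2) := by
            rw [Real.exp_add, add_div, Real.exp_add]; ring
        _ ≤ _ := by
            gcongr
            have : v^2/D + 2*v^2/D^2 = v^2 * ((D+2)/D^2) := by field_simp
            rw [this, div_eq_mul_one_div (v^2)]
            refine mul_le_mul_of_nonneg_left ?_ (sq_nonneg v)
            rw [div_le_div_iff₀ (by positivity) (by linarith)]
            nlinarith
    calc _ ≤ ∑ χ : Fin n → Bool, 2 * Real.exp (1/D) * Real.exp ((lin (fun i => c i.succ) χ)^2/(D-2)) :=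
          Finset.sum_le_sum fun χ _ => key χ
      _ = 2 * Real.exp (1/D) * ∑ χ : Fin n → Bool, Real.exp ((lin (fun i => c i.succ) χ)^2/(D-2)) := by
          rw [Finset.mul_sum]
      _ ≤ 2 * Real.exp (1/D) * (2^n * Real.exp (n / (D - 2 - 2*n))) := by
          gcongr
          exact ih (D-2) (by linarith) _ (fun i => hc _)
      _ = 2^(n+1) * Real.exp (1/D + n/(D-2-2*n)) := by rw [Real.exp_add]; ring
      _ ≤ _ := by
          gcongr
          push_cast
          have : D - 2*((n:ℝ)+1) = D - 2 - 2*n := by ring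
          rw [this, add_comm (n:ℝ) 1, add_div]
          gcongr <;> linarith

lemma exp_mgf (n : ℕ) (t : ℝ) (c : Fin n → ℝ) (hc : ∀ i, (c i)^2 = 1) :
    ∑ χ, Real.exp (t * lin c χ) = (2 * Real.cosh t)^n := by
  induction n with
  | zero => simp [lin]
  | succ n ih =>
    rw [sum_cons_cube]
    have : ∀ χ : Fin n → Bool, Real.exp (t * lin c (Fin.cons true χ)) +
        Real.exp (t * lin c (Fin.cons false χ))
        = 2 * Real.cosh t * Real.exp (t * lin (fun i => c i.succ) χ) := by
      intro χ
      rw [lin_cons_true, lin_cons_false]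
      have h : Real.cosh t = Real.cosh (t * c 0) := by
        rcases (by simpa using hc 0 : c 0 = 1 ∨ c 0 = -1) with h | h
        · rw [h]; simp
        · rw [h]; simp
      rw [h, Real.cosh_eq, mul_add, mul_sub, Real.exp_add, sub_eq_add_neg, Real.exp_add]; ring
    simp only [this]
    rw [← Finset.mul_sum, ih _ (fun i => hc _)]; ring

lemma geom_int (q : ℝ) (hq0 : 0 ≤ q) (hq : q ≤ 1/2) (T : Finset ℤ) :
    ∑ s ∈ T, q ^ s.natAbs ≤ 1 + 4 * q := by
  have h1 : HasSum (fun n : ℕ => q ^ (n : ℤ).natAbs) (1 - q)⁻¹ := by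
    simpa using hasSum_geometric_of_lt_one hq0 (by linarith)
  have h2 : HasSum (fun n : ℕ => q ^ (-((n : ℤ) + 1)).natAbs) (q * (1 - q)⁻¹) := by
    have := (hasSum_geometric_of_lt_one hq0 (by linarith)).mul_left q
    have e : (fun n : ℕ => q ^ (-((n : ℤ) + 1)).natAbs) = fun n : ℕ => q * q ^ n := by
      funext n
      rw [Int.natAbs_neg, ← pow_succ']
      rfl
    rw [e]; exact this
  have h3 := HasSum.of_nat_of_neg_add_one (f := fun s : ℤ => q ^ s.natAbs) h1 h2
  refine (sum_le_hasSum T (fun i _ => by positivity) h3).trans ?_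
  have : 0 < 1 - q := by linarith
  rw [← one_add_mul, ← div_eq_mul_inv, div_le_iff₀ this]
  nlinarith

lemma gauss_int (η A : ℝ) (_ : 0 < η) (hA : 1 ≤ A) (h : 4 * Real.exp (-A) ≤ η) (T : Finset ℤ) :
    ∑ s ∈ T, Real.exp (-(η + A * (s:ℝ)^2)) ≤ 1 := by
  have hq : Real.exp (-A) ≤ 1/2 := by
    rw [Real.exp_neg]
    have := Real.add_one_le_exp A
    rw [inv_le_comm₀ (Real.exp_pos _) (by norm_num)]
    linarith
  have h1 := geom_int (Real.exp (-A)) (Real.exp_pos _).le hq T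
  have h2 : ∀ s ∈ T, Real.exp (-(η + A * (s:ℝ)^2)) ≤ Real.exp (-η) * Real.exp (-A) ^ s.natAbs := by
    intro s _
    rw [← Real.exp_nat_mul, ← Real.exp_add]
    apply Real.exp_le_exp.mpr
    have : ((s.natAbs : ℕ) : ℝ) ≤ (s:ℝ)^2 := by
      have h : s.natAbs ≤ s.natAbs^2 := Nat.le_self_pow (by norm_num) _
      have h' : ((s.natAbs^2 : ℕ) : ℝ) = (s:ℝ)^2 := by
        rw [← Int.cast_natCast]; push_cast; simp
      rw [← h']; exact_mod_cast h
    nlinarith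
  calc _ ≤ ∑ s ∈ T, Real.exp (-η) * Real.exp (-A) ^ s.natAbs := Finset.sum_le_sum h2
    _ = Real.exp (-η) * ∑ s ∈ T, Real.exp (-A) ^ s.natAbs := by rw [Finset.mul_sum]
    _ ≤ Real.exp (-η) * (1 + η) := by gcongr; linarith
    _ ≤ Real.exp (-η) * Real.exp η := by gcongr; linarith [Real.add_one_le_exp η]
    _ = 1 := by rw [← Real.exp_add]; simp

lemma pigeon {Ω : Type} [Fintype Ω] [Nonempty Ω] (m : ℕ) (b : Ω → Fin m → ℤ) (φ : ℤ → ℝ)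
    (hφ : ∀ T : Finset ℤ, ∑ s ∈ T, Real.exp (-φ s) ≤ 1) (E : ℝ)
    (hE : ∑ χ, ∑ k, φ (b χ k) ≤ Fintype.card Ω * E) :
    ∃ β, (Fintype.card Ω : ℝ) * Real.exp (-E) ≤ (Finset.univ.filter fun χ => b χ = β).card := by
  by_contra hcon
  push Not at hcon
  let Φ : (Fin m → ℤ) → ℝ := fun β => ∑ k, φ (β k)
  have h1 : (Fintype.card Ω : ℝ) * Real.exp (-E) ≤ ∑ χ, Real.exp (-Φ (b χ)) := by
    have : ∀ χ, Real.exp (-E) * (1 + E - Φ (b χ)) ≤ Real.exp (-Φ (b χ)) := by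
      intro χ
      have h := Real.add_one_le_exp (E - Φ (b χ))
      calc _ ≤ Real.exp (-E) * Real.exp (E - Φ (b χ)) := by gcongr; linarith
        _ = _ := by rw [← Real.exp_add]; congr 1; ring
    calc _ ≤ Real.exp (-E) * ∑ χ, (1 + E - Φ (b χ)) := by
          rw [mul_comm]; gcongr
          rw [Finset.sum_sub_distrib]
          simp only [Finset.sum_const, Finset.card_univ, nsmul_eq_mul]
          change _ ≤ _ - ∑ χ, ∑ k, φ (b χ k)
          linarith
      _ ≤ _ := by rw [Finset.mul_sum]; exact Finset.sum_le_sum fun χ _ => this χ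
  let I := Finset.univ.image b
  have h2 : ∑ χ, Real.exp (-Φ (b χ)) =
      ∑ β ∈ I, ((Finset.univ.filter fun χ => b χ = β).card : ℝ) * Real.exp (-Φ β) := by
    rw [Finset.sum_comp (fun β => Real.exp (-Φ β)) b]
    simp [I]
  have hI : I.Nonempty := Finset.univ_nonempty.image b
  have h3 : ∑ β ∈ I, ((Finset.univ.filter fun χ => b χ = β).card : ℝ) * Real.exp (-Φ β)
      < ∑ β ∈ I, ((Fintype.card Ω : ℝ) * Real.exp (-E)) * Real.exp (-Φ β) := by
    apply Finset.sum_lt_sum_of_nonempty hI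
    intro β _
    exact mul_lt_mul_of_pos_right (hcon β) (Real.exp_pos _)
  have h4 : ∑ β ∈ I, Real.exp (-Φ β) ≤ 1 := by
    let T : Fin m → Finset ℤ := fun k => Finset.univ.image fun χ => b χ k
    calc ∑ β ∈ I, Real.exp (-Φ β) ≤ ∑ β ∈ Fintype.piFinset T, Real.exp (-Φ β) := by
          apply Finset.sum_le_sum_of_subset_of_nonneg
          · intro β hβ
            obtain ⟨χ, -, rfl⟩ := Finset.mem_image.mp hβ
            rw [Fintype.mem_piFinset]
            intro k
            exact Finset.mem_image_of_mem _ (Finset.mem_univ χ)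
          · intros; positivity
      _ = ∑ β ∈ Fintype.piFinset T, ∏ k, Real.exp (-φ (β k)) := by
          apply Finset.sum_congr rfl
          intro β _
          rw [← Real.exp_sum]; simp [Φ]
      _ = ∏ k, ∑ s ∈ T k, Real.exp (-φ s) := by rw [Finset.prod_univ_sum]
      _ ≤ 1 := by
          apply Finset.prod_le_one
          · intros; positivity
          · intros; exact hφ _
  rw [← Finset.mul_sum] at h3
  have h5 : (0:ℝ) ≤ Fintype.card Ω * Real.exp (-E) := by positivity
  nlinarith

lemma hamming_sum (n : ℕ) (χ : Fin n → Bool) :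
    ∑ χ' : Fin n → Bool, (1/4:ℝ) ^ (Finset.univ.filter fun i => χ i ≠ χ' i).card = (5/4)^n := by
  have : ∀ χ' : Fin n → Bool, (1/4:ℝ) ^ (Finset.univ.filter fun i => χ i ≠ χ' i).card
      = ∏ i, (if χ i ≠ χ' i then (1/4:ℝ) else 1) := by
    intro χ'
    rw [Finset.prod_ite]; simp
  simp only [this]
  rw [← Fintype.piFinset_univ, ← Finset.prod_univ_sum (fun _ => Finset.univ)
    (fun i b => if χ i ≠ b then (1/4:ℝ) else 1)]
  have : ∀ i, ∑ b : Bool, (if χ i ≠ b then (1/4:ℝ) else 1) = 5/4 := by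
    intro i; cases χ i <;> simp <;> norm_num
  rw [Finset.prod_congr rfl (fun i _ => this i)]
  simp
  rw [div_pow]

lemma num_aux (n : ℕ) (hn : 1 ≤ n) :
    (5/4:ℝ)^n < 2^n * Real.exp (-(n/4)) * (Real.exp (-(n * (Real.log 4/8)))) := by
  have h4 : Real.log 4 = 2 * Real.log 2 := by
    rw [show (4:ℝ) = 2^2 by norm_num, Real.log_pow]; simp
  set g := Real.exp (-(1/4 + Real.log 2/4)) with hg
  have hgn : 2^n * Real.exp (-((n:ℝ)/4)) * (Real.exp (-(n * (Real.log 4/8)))) = (2*g)^n := by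
    rw [mul_pow, hg, ← Real.exp_nat_mul, mul_assoc, ← Real.exp_add, h4]
    congr 2; ring
  rw [hgn]
  apply pow_lt_pow_left₀ _ (by norm_num) (by omega)
  have hg4 : g^4 = Real.exp (-1) / 2 := by
    rw [hg, ← Real.exp_nat_mul]
    have : ((4:ℕ):ℝ) * -(1/4 + Real.log 2/4) = -1 + -Real.log 2 := by push_cast; ring
    rw [this, Real.exp_add, Real.exp_neg (Real.log 2), Real.exp_log (by norm_num)]; ring
  have he : (5/8:ℝ)^4 < g^4 := by
    rw [hg4, Real.exp_neg]
    have := Real.exp_one_lt_d9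
    have h0 := Real.exp_pos 1
    rw [lt_div_iff₀ (by norm_num), lt_inv_comm₀ (by norm_num) h0]
    norm_num; linarith
  have := lt_of_pow_lt_pow_left₀ 4 (Real.exp_pos _).le he
  linarith

lemma round_sq (u : ℝ) : ((round u : ℤ) : ℝ)^2 ≤ 16 * u^4 := by
  have h := abs_sub_round u
  by_cases hb : round u = 0
  · rw [hb]; simp; positivity
  · have h1 : (1:ℝ) ≤ |((round u : ℤ):ℝ)| := by
      exact_mod_cast Int.one_le_abs hb
    have h2 : |((round u : ℤ):ℝ)| ≤ |u| + 1/2 := by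
      have := abs_sub_abs_le_abs_sub ((round u : ℤ):ℝ) u
      rw [abs_sub_comm] at this; linarith
    have h3 : 1/2 ≤ |u| := by linarith
    have h4 : |((round u : ℤ):ℝ)| ≤ 2*|u| := by linarith
    have h5 : 2*|u| ≤ 4 * |u|^2 := by nlinarith
    rw [← sq_abs]
    calc _ ≤ (4 * |u|^2)^2 := by gcongr; linarith
      _ = 16 * u^4 := by rw [sq_abs]; ring

lemma partial_coloring (n m : ℕ) (hn : 1 ≤ n) (ρ Δ : ℝ) (hρ : 1 ≤ ρ) (hm : (m:ℝ) ≤ n * ρ^2)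
    (hΔ0 : 0 < Δ) (hΔ : 288 * n^2 * ρ^3 ≤ Δ^4) (r : Fin m → Fin n → ℝ) (hr : ∀ k i, |r k i| ≤ 1) :
    ∃ χ χ' : Fin n → Bool, n ≤ 8 * (Finset.univ.filter fun i => χ i ≠ χ' i).card ∧
      ∀ k, |lin (r k) χ - lin (r k) χ'| ≤ 2 * Δ := by
  have hn0 : (0:ℝ) < n := by exact_mod_cast hn
  have hρ0 : 0 < ρ := by linarith
  set b : (Fin n → Bool) → Fin m → ℤ := fun χ k => round (lin (r k) χ / (2*Δ)) with hb
  set η : ℝ := 1/(8*ρ^2) with hη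
  set A : ℝ := 12 * ρ with hA
  have hη0 : 0 < η := by positivity
  have hexp : 4 * Real.exp (-A) ≤ η := by
    rw [Real.exp_neg, hη, ← div_eq_mul_inv, div_le_div_iff₀ (Real.exp_pos _) (by positivity)]
    have := Real.quadratic_le_exp_of_nonneg (x := A) (by positivity)
    rw [hA] at this ⊢
    nlinarith
  have hφ := gauss_int η A hη0 (by linarith) hexp
  have hcard : (Fintype.card (Fin n → Bool) : ℝ) = 2^n := by simp
  have hE : ∑ χ, ∑ k, (η + A * ((b χ k : ℤ):ℝ)^2) ≤ Fintype.card (Fin n → Bool) * ((n:ℝ)/4) := by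
    rw [Finset.sum_comm, hcard]
    have hk : ∀ k, ∑ χ, (η + A * ((b χ k : ℤ):ℝ)^2) ≤ 2^n * (η + A * (3 * n^2 / Δ^4)) := by
      intro k
      have h1 : ∀ χ, η + A * ((b χ k : ℤ):ℝ)^2 ≤ η + A / Δ^4 * (lin (r k) χ)^4 := by
        intro χ
        have := round_sq (lin (r k) χ / (2*Δ))
        have e : 16 * (lin (r k) χ / (2*Δ))^4 = (lin (r k) χ)^4 / Δ^4 := by
          field_simp; ring
        rw [e] at this
        have : A * ((b χ k : ℤ):ℝ)^2 ≤ A * ((lin (r k) χ)^4 / Δ^4) := by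
          apply mul_le_mul_of_nonneg_left this; positivity
        calc _ ≤ η + A * ((lin (r k) χ)^4 / Δ^4) := by linarith
          _ = _ := by ring
      have h2 := mom4 n (r k)
      have h3 : ∑ i, (r k i)^2 ≤ n := by
        calc _ ≤ ∑ i : Fin n, (1:ℝ) := by
              apply Finset.sum_le_sum; intro i _
              rw [← sq_abs]; exact pow_le_one₀ (abs_nonneg _) (hr k i)
          _ = n := by simp
      have h3' : 0 ≤ ∑ i, (r k i)^2 := Finset.sum_nonneg fun i _ => sq_nonneg _
      have h4 : ∑ χ, (lin (r k) χ)^4 ≤ 2^n * (3 * (n:ℝ)^2) := by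
        refine h2.trans ?_
        gcongr
      calc _ ≤ ∑ χ, (η + A / Δ^4 * (lin (r k) χ)^4) := Finset.sum_le_sum fun χ _ => h1 χ
        _ = 2^n * η + A/Δ^4 * ∑ χ, (lin (r k) χ)^4 := by
            rw [Finset.sum_add_distrib, ← Finset.mul_sum]; simp
        _ ≤ 2^n * η + A/Δ^4 * (2^n * (3 * (n:ℝ)^2)) := by gcongr
        _ = _ := by ring
    have h5 : A * (3 * n^2 / Δ^4) ≤ η := by
      rw [hA, hη, ← mul_div_assoc, div_le_div_iff₀ (by positivity) (by positivity)]
      nlinarith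
    calc _ ≤ ∑ k : Fin m, 2^n * (η + A * (3 * n^2 / Δ^4)) := Finset.sum_le_sum fun k _ => hk k
      _ = m * (2^n * (η + A * (3 * n^2 / Δ^4))) := by simp
      _ ≤ (n*ρ^2) * (2^n * (η + η)) := by gcongr
      _ = _ := by rw [hη]; field_simp; norm_num
  obtain ⟨β, hβ⟩ := pigeon m b (fun s => η + A * (s:ℝ)^2) hφ _ hE
  rw [hcard] at hβ
  set K := Finset.univ.filter fun χ => b χ = β with hK
  have hKne : K.Nonempty := by
    rw [← Finset.card_pos]
    have : (0:ℝ) < K.card := lt_of_lt_of_le (by positivity) hβ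
    exact_mod_cast this
  obtain ⟨χ, hχ⟩ := hKne
  by_contra hcon
  push Not at hcon
  have hdist : ∀ χ' ∈ K, 8 * (Finset.univ.filter fun i => χ i ≠ χ' i).card < n := by
    intro χ' hχ'
    by_contra hge
    push Not at hge
    obtain ⟨k, hk⟩ := hcon χ χ' hge
    have e1 : b χ k = b χ' k := by
      rw [hK, Finset.mem_filter] at hχ hχ'
      rw [hχ.2, hχ'.2]
    have a1 := abs_sub_round (lin (r k) χ / (2*Δ))
    have a2 := abs_sub_round (lin (r k) χ' / (2*Δ))
    change round (lin (r k) χ / (2*Δ)) = round (lin (r k) χ' / (2*Δ)) at e1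
    rw [e1] at a1
    have a3 : |lin (r k) χ / (2*Δ) - lin (r k) χ' / (2*Δ)| ≤ 1 := by
      rw [abs_le] at *; constructor <;> linarith [a1.1, a1.2, a2.1, a2.2]
    rw [← sub_div, abs_div, abs_of_pos (show 0 < 2*Δ by positivity), div_le_one (by positivity)] at a3
    linarith
  have hsum : (K.card : ℝ) * Real.exp (-(n * (Real.log 4/8))) ≤ (5/4)^n := by
    rw [← hamming_sum n χ, ← nsmul_eq_mul, ← Finset.sum_const]
    calc _ ≤ ∑ χ' ∈ K, (1/4:ℝ) ^ (Finset.univ.filter fun i => χ i ≠ χ' i).card := by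
          apply Finset.sum_le_sum
          intro χ' hχ'
          have h8 : (8:ℝ) * (Finset.univ.filter fun i => χ i ≠ χ' i).card ≤ n := by
            exact_mod_cast (hdist χ' hχ').le
          have : (1/4:ℝ) = Real.exp (-Real.log 4) := by
            rw [Real.exp_neg, Real.exp_log (by norm_num)]; norm_num
          rw [this, ← Real.exp_nat_mul]
          apply Real.exp_le_exp.mpr
          have : 0 < Real.log 4 := Real.log_pos (by norm_num)
          nlinarith
      _ ≤ _ := Finset.sum_le_sum_of_subset_of_nonneg (Finset.subset_univ _)
          (fun _ _ _ => by positivity)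
  have := num_aux n hn
  have h9 : 2^n * Real.exp (-((n:ℝ)/4)) * (Real.exp (-(n * (Real.log 4/8))))
    ≤ (K.card : ℝ) * Real.exp (-(n * (Real.log 4/8))) := by gcongr
  linarith

lemma full_coloring (N m : ℕ) (hN : 1 ≤ N) (hm : m ≤ N) (r : Fin m → Fin N → ℝ)
    (hr : ∀ k i, |r k i| ≤ 1) (P : ℝ) (hP0 : 0 < P) (hP : P^8 = N) :
    ∀ (n : ℕ) (F : Finset (Fin N)), F.card = n → ∀ Q : ℝ, 0 ≤ Q → Q^8 = n →
      ∃ χ : Fin N → ℤ, (∀ i ∈ F, χ i = 1 ∨ χ i = -1) ∧ (∀ i, i ∉ F → χ i = 0) ∧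
        ∀ k, |∑ i, r k i * (χ i : ℝ)| ≤ 320 * P^3 * Q := by
  intro n
  induction n using Nat.strong_induction_on with
  | _ n ih =>
  intro F hF Q hQ0 hQ
  rcases Nat.eq_zero_or_pos n with h0 | hn
  · subst h0
    rw [Finset.card_eq_zero] at hF
    subst hF
    refine ⟨fun _ => 0, by simp, by simp, fun k => ?_⟩
    simp; positivity
  have hnr : (0:ℝ) < n := by exact_mod_cast hn
  have hQpos : 0 < Q := by
    rcases hQ0.lt_or_eq with h | h
    · exact h
    · rw [← h] at hQ; simp at hQ; linarith
  have hnN : n ≤ N := by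
    have := Finset.card_le_univ F
    simp at this; omega
  have hQP : Q ≤ P := by
    apply le_of_pow_le_pow_left₀ (n := 8) (by norm_num) hP0.le
    rw [hQ, hP]; exact_mod_cast hnN
  let e : Fin n ≃ F := (F.equivFinOfCardEq hF).symm
  have hρ : 1 ≤ P^4/Q^4 := by
    rw [le_div_iff₀ (by positivity), one_mul]; gcongr
  obtain ⟨c, c', hd, hk⟩ := partial_coloring n m hn (P^4/Q^4) (5*P^3*Q) hρ
    (by
      have : (n:ℝ) * (P^4/Q^4)^2 = N := by rw [← hQ, ← hP]; field_simp
      rw [this]; exact_mod_cast hm)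
    (by positivity)
    (by
      rw [← hQ]
      have e1 : 288 * (Q^8)^2 * (P^4/Q^4)^3 = 288 * (P^12 * Q^4) := by field_simp
      have e2 : (5*P^3*Q)^4 = 625 * (P^12 * Q^4) := by ring
      rw [e1, e2]
      have : 0 < P^12 * Q^4 := by positivity
      linarith)
    (fun k i => r k (e i)) (fun k i => hr _ _)
  let d : Fin n → ℤ := fun j => if c j = c' j then 0 else if c j then 1 else -1
  have hdr : ∀ j, ((d j : ℤ):ℝ) = (pmVal (c j) - pmVal (c' j))/2 := by
    intro j
    simp only [d]
    cases c j <;> cases c' j <;> simp [pmVal] <;> norm_num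
  let χ0 : Fin N → ℤ := fun i => if h : i ∈ F then d (e.symm ⟨i, h⟩) else 0
  have hχ0e : ∀ j, χ0 (e j) = d j := by
    intro j
    simp [χ0]
  have hsum0 : ∀ k, ∑ i, r k i * (χ0 i : ℝ) = ∑ j, r k (e j) * (d j : ℝ) := by
    intro k
    have h1 : ∑ i, r k i * (χ0 i : ℝ) = ∑ i ∈ F, r k i * (χ0 i : ℝ) := by
      symm
      apply Finset.sum_subset (Finset.subset_univ _)
      intro i _ hi
      simp [χ0, hi]
    rw [h1, ← Finset.sum_coe_sort F, ← e.sum_comp]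
    simp only [hχ0e]
  let F' := F.filter fun i => χ0 i = 0
  have hcard : 8 * F'.card ≤ 7 * n := by
    have h1 : (F.filter fun i => ¬ χ0 i = 0).card = (Finset.univ.filter fun i => c i ≠ c' i).card := by
      symm
      apply Finset.card_bij (fun j _ => (e j : Fin N))
      · intro j hj
        simp only [Finset.mem_filter, Finset.mem_univ, true_and] at hj ⊢
        refine ⟨(e j).2, ?_⟩
        rw [hχ0e]; simp only [d, if_neg hj]; split_ifs <;> norm_num
      · intro j _ j' _ h
        exact e.injective (Subtype.ext h)
      · intro i hi
        simp only [Finset.mem_filter] at hi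
        refine ⟨e.symm ⟨i, hi.1⟩, ?_, by simp⟩
        simp only [Finset.mem_filter, Finset.mem_univ, true_and]
        intro hc
        apply hi.2
        simp [χ0, hi.1, d, hc]
    have h2 := Finset.card_filter_add_card_filter_not (s := F) (fun i => χ0 i = 0)
    have h3 : F'.card = (F.filter fun i => χ0 i = 0).card := rfl
    omega
  set Q' : ℝ := (F'.card : ℝ) ^ ((1:ℝ)/8) with hQ'
  have hQ'0 : 0 ≤ Q' := by positivity
  have hQ'8 : Q'^8 = F'.card := by
    rw [hQ', ← Real.rpow_natCast, ← Real.rpow_mul (by positivity)]; norm_num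
  obtain ⟨χ1, h11, h12, h13⟩ := ih F'.card (by omega) F' rfl Q' hQ'0 hQ'8
  have hQQ : Q' ≤ 63/64 * Q := by
    apply le_of_pow_le_pow_left₀ (n := 8) (by norm_num) (by positivity)
    rw [hQ'8, mul_pow, hQ]
    have : (8:ℝ) * F'.card ≤ 7 * n := by exact_mod_cast hcard
    norm_num
    linarith
  refine ⟨fun i => χ0 i + χ1 i, ?_, ?_, ?_⟩
  · intro i hi
    by_cases hz : χ0 i = 0
    · have : i ∈ F' := by simp [F', hi, hz]
      simpa [hz] using h11 i this
    · have : i ∉ F' := by simp [F', hz]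
      simp only [h12 i this, add_zero]
      simp only [χ0, hi, dif_pos, d] at hz ⊢
      split_ifs at hz ⊢ <;> simp_all
  · intro i hi
    have : i ∉ F' := by simp [F', hi]
    simp [h12 i this, χ0, hi]
  · intro k
    have h1 : |∑ i, r k i * (χ0 i : ℝ)| ≤ 5*P^3*Q := by
      rw [hsum0]
      have h2 := hk k
      have : lin (fun i => r k (e i)) c - lin (fun i => r k (e i)) c' = 2 * ∑ j, r k (e j) * (d j : ℝ) := by
        simp only [lin]
        rw [← Finset.sum_sub_distrib, Finset.mul_sum]
        apply Finset.sum_congr rfl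
        intro j _
        rw [hdr]; ring
      rw [this, abs_mul, abs_two] at h2
      linarith
    have h2 := h13 k
    have : ∑ i, r k i * ((χ0 i + χ1 i : ℤ) : ℝ) = ∑ i, r k i * (χ0 i : ℝ) + ∑ i, r k i * (χ1 i : ℝ) := by
      rw [← Finset.sum_add_distrib]; apply Finset.sum_congr rfl; intro i _; push_cast; ring
    rw [this]
    refine (abs_add_le _ _).trans ?_
    have h3 : 320 * P^3 * Q' ≤ 320 * P^3 * (63/64 * Q) := by gcongr
    nlinarith

lemma her_disc (N m : ℕ) (hN : 1 ≤ N) (hm : m ≤ N) (r : Fin m → Fin N → ℝ)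
    (hr : ∀ k i, |r k i| ≤ 1) (F : Finset (Fin N)) :
    ∃ χ : Fin N → ℤ, (∀ i ∈ F, χ i = 1 ∨ χ i = -1) ∧ (∀ i, i ∉ F → χ i = 0) ∧
        ∀ k, |∑ i, r k i * (χ i : ℝ)| ≤ 320 * Real.sqrt N := by
  have hN0 : (0:ℝ) < N := by exact_mod_cast hN
  set P : ℝ := (N : ℝ) ^ ((1:ℝ)/8) with hP
  have hP0 : 0 < P := by positivity
  have hP8 : P^8 = N := by
    rw [hP, ← Real.rpow_natCast, ← Real.rpow_mul (by positivity)]; norm_num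
  have hs : Real.sqrt N = P^4 := by
    rw [← hP8, show P^8 = (P^4)^2 by ring, Real.sqrt_sq (by positivity)]
  set Q : ℝ := (F.card : ℝ) ^ ((1:ℝ)/8) with hQ
  have hQ0 : 0 ≤ Q := by positivity
  have hQ8 : Q^8 = F.card := by
    rw [hQ, ← Real.rpow_natCast, ← Real.rpow_mul (by positivity)]; norm_num
  have hQP : Q ≤ P := by
    apply le_of_pow_le_pow_left₀ (n := 8) (by norm_num) hP0.le
    rw [hQ8, hP8]
    have := Finset.card_le_univ F
    simp at this
    exact_mod_cast this
  obtain ⟨χ, h1, h2, h3⟩ := full_coloring N m hN hm r hr P hP0 hP8 F.card F rfl Q hQ0 hQ8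
  refine ⟨χ, h1, h2, fun k => (h3 k).trans ?_⟩
  rw [hs]
  calc 320 * P^3 * Q ≤ 320 * P^3 * P := by gcongr
    _ = _ := by ring

lemma bit_round (N m : ℕ) (r : Fin m → Fin N → ℝ) (E : ℝ)
    (H : ∀ F : Finset (Fin N), ∃ χ : Fin N → ℤ, (∀ i ∈ F, χ i = 1 ∨ χ i = -1) ∧
      (∀ i, i ∉ F → χ i = 0) ∧ ∀ k, |∑ i, r k i * (χ i : ℝ)| ≤ E) (b : ℕ) :
    ∀ z : Fin N → ℤ, (∀ i, |z i| ≤ 2^b) → ∃ y : Fin N → Bool,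
      ∀ k, |∑ i, r k i * ((z i : ℝ) - 2^b * pmVal (y i))| ≤ (2^(b+1) - 1) * E := by
  induction b with
  | zero =>
    intro z hz
    obtain ⟨χ, h1, h2, h3⟩ := H (Finset.univ.filter fun i => z i = 0)
    refine ⟨fun i => decide (z i + χ i = 1), fun k => ?_⟩
    have : ∑ i, r k i * ((z i : ℝ) - 2^0 * pmVal (decide (z i + χ i = 1)))
        = -∑ i, r k i * (χ i : ℝ) := by
      rw [← Finset.sum_neg_distrib]
      apply Finset.sum_congr rfl
      intro i _
      have hi := hz i
      simp only [pow_zero] at hi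
      rw [abs_le] at hi
      have hzz : z i = 0 ∨ z i = 1 ∨ z i = -1 := by omega
      rcases hzz with h | h | h
      · rcases h1 i (by simp [h]) with h' | h' <;> simp [h, h', pmVal]
      · have := h2 i (by simp [h]); simp [h, this, pmVal]
      · have := h2 i (by simp [h]); simp [h, this, pmVal]
    rw [this, abs_neg]
    refine (h3 k).trans ?_
    norm_num
  | succ b ih =>
    intro z hz
    obtain ⟨χ, h1, h2, h3⟩ := H (Finset.univ.filter fun i => z i % 2 = 1)
    have hpar : ∀ i, (z i + χ i) = 2 * ((z i + χ i)/2) ∧ |(z i + χ i)/2| ≤ 2^b := by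
      intro i
      have hi := hz i
      rw [pow_succ, abs_le] at hi
      rw [abs_le]
      have hp : (1:ℤ) ≤ 2^b := one_le_pow₀ (by norm_num)
      rcases Int.emod_two_eq_zero_or_one (z i) with h | h
      · have := h2 i (by simp [h]); omega
      · rcases h1 i (by simp [h]) with h' | h' <;> omega
    obtain ⟨y, hy⟩ := ih (fun i => (z i + χ i)/2) (fun i => (hpar i).2)
    refine ⟨y, fun k => ?_⟩
    have : ∑ i, r k i * ((z i : ℝ) - 2^(b+1) * pmVal (y i))
        = 2 * ∑ i, r k i * ((((z i + χ i)/2 : ℤ) : ℝ) - 2^b * pmVal (y i)) - ∑ i, r k i * (χ i : ℝ) := by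
      rw [Finset.mul_sum, ← Finset.sum_sub_distrib]
      apply Finset.sum_congr rfl
      intro i _
      have h : ((z i : ℝ) + χ i) = 2 * (((z i + χ i)/2 : ℤ) : ℝ) := by
        exact_mod_cast (hpar i).1
      have h' : (z i : ℝ) = 2 * (((z i + χ i)/2 : ℤ) : ℝ) - χ i := by linarith
      rw [h']; ring
    rw [this]
    refine (abs_sub _ _).trans ?_
    rw [abs_mul, abs_two]
    have a := hy k
    have b' := h3 k
    rw [pow_succ (2:ℝ) (b+1)]
    linarith

lemma round_mono_aux {a b : ℝ} (h : a ≤ b) : round a ≤ round b := by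
  rw [round_eq, round_eq]; exact Int.floor_le_floor (by linarith)

lemma lin_round (N m : ℕ) (hN : 1 ≤ N) (hm : m ≤ N) (r : Fin m → Fin N → ℝ)
    (hr : ∀ k i, |r k i| ≤ 1) (w : Fin N → ℝ) (hw : ∀ i, |w i| ≤ 1) :
    ∃ y : Fin N → Bool, ∀ k, |∑ i, r k i * (w i - pmVal (y i))| ≤ 641 * Real.sqrt N := by
  set B : ℝ := 2^N with hB
  have hB0 : 0 < B := by positivity
  have hBN : (N:ℝ) ≤ B := by
    have := Nat.lt_two_pow_self (n := N)
    rw [hB]; exact_mod_cast this.le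
  have hs1 : 1 ≤ Real.sqrt N := by
    rw [Real.one_le_sqrt]; exact_mod_cast hN
  obtain ⟨y, hy⟩ := bit_round N m r (320 * Real.sqrt N) (her_disc N m hN hm r hr) N
    (fun i => round (B * w i)) (by
      intro i
      have h1 : B * w i ≤ ((2^N : ℤ) : ℝ) := by
        push_cast; rw [← hB]; nlinarith [(abs_le.mp (hw i)).2]
      have h2 : ((-2^N : ℤ) : ℝ) ≤ B * w i := by
        push_cast; rw [← hB]; nlinarith [(abs_le.mp (hw i)).1]
      rw [abs_le]
      have a := round_mono_aux h1
      have b := round_mono_aux h2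
      rw [round_intCast] at a b
      exact ⟨b, a⟩)
  refine ⟨y, fun k => ?_⟩
  have hk := hy k
  rw [← hB, pow_succ, ← hB] at hk
  have e : B * ∑ i, r k i * (w i - pmVal (y i)) =
      ∑ i, r k i * (((round (B * w i) : ℤ):ℝ) - B * pmVal (y i))
      + ∑ i, r k i * (B * w i - ((round (B * w i) : ℤ):ℝ)) := by
    rw [Finset.mul_sum, ← Finset.sum_add_distrib]
    apply Finset.sum_congr rfl; intro i _; ring
  have h2 : |∑ i, r k i * (B * w i - ((round (B * w i) : ℤ):ℝ))| ≤ N := by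
    refine (Finset.abs_sum_le_sum_abs _ _).trans ?_
    calc _ ≤ ∑ i : Fin N, (1:ℝ) := by
          apply Finset.sum_le_sum; intro i _
          rw [abs_mul]
          have := abs_sub_round (B * w i)
          have := hr k i
          have := abs_nonneg (r k i)
          nlinarith [abs_nonneg (B * w i - ((round (B * w i) : ℤ):ℝ))]
      _ = N := by simp
  have h3 : B * |∑ i, r k i * (w i - pmVal (y i))| ≤ B * (641 * Real.sqrt N) := by
    rw [← abs_of_pos hB0, ← abs_mul, abs_of_pos hB0, e]
    refine (abs_add_le _ _).trans ?_
    nlinarith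
  exact le_of_mul_le_mul_left h3 hB0

lemma minimax (m N : ℕ) (X : Fin m → Fin N → ℝ) (θ : ℝ)
    (h : ∀ l : Fin m → ℝ, (∀ k, 0 ≤ l k) → θ * ∑ k, l k ≤ ∑ i, |∑ k, l k * X k i|) :
    ∃ w : Fin N → ℝ, (∀ i, |w i| ≤ 1) ∧ ∀ k, θ ≤ ∑ i, X k i * w i := by
  let T : (Fin N → ℝ) →ₗ[ℝ] (Fin m → ℝ) := Matrix.mulVecLin (Matrix.of X)
  have hT : ∀ w k, T w k = ∑ i, X k i * w i := by
    intro w k; simp [T, Matrix.mulVec, dotProduct]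
  let K0 : Set (Fin N → ℝ) := Set.Icc (fun _ => -1) (fun _ => 1)
  let D : Set (Fin m → ℝ) := Set.Ici (fun _ => θ)
  by_contra hcon
  push Not at hcon
  have hdisj : Disjoint (T '' K0) D := by
    rw [Set.disjoint_left]
    rintro _ ⟨w, hw, rfl⟩ hD
    obtain ⟨k, hk⟩ := hcon w (fun i => abs_le.mpr ⟨hw.1 i, hw.2 i⟩)
    have := hD k
    rw [hT] at this
    linarith
  have hc : IsCompact (T '' K0) :=
    isCompact_Icc.image (LinearMap.continuous_of_finiteDimensional T)
  have hcv : Convex ℝ (T '' K0) := (convex_Icc _ _).linear_image T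
  obtain ⟨f, u, v, hf1, huv, hf2⟩ := geometric_hahn_banach_compact_closed hcv hc
    (convex_Ici _) isClosed_Ici hdisj
  let l : Fin m → ℝ := fun k => f (Pi.single k 1)
  have hf : ∀ x : Fin m → ℝ, f x = ∑ k, l k * x k := by
    intro x
    have := LinearMap.pi_apply_eq_sum_univ f.toLinearMap x
    have e : f x = f.toLinearMap x := rfl
    rw [e, this]
    apply Finset.sum_congr rfl
    intro k _
    simp only [l, smul_eq_mul]
    rw [mul_comm]
    congr 1
    change f _ = f _
    congr 1
    ext j
    simp [Pi.single_apply, eq_comm]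
  have hθ : v < ∑ k, l k * θ := by
    rw [← hf]; exact hf2 _ (Set.mem_Ici.mpr le_rfl)
  have hl : ∀ k, 0 ≤ l k := by
    intro k
    by_contra hneg
    push Not at hneg
    let s := (∑ k, l k * θ - v) / (-l k)
    have hs : 0 ≤ s := by apply div_nonneg <;> linarith
    have := hf2 ((fun _ => θ) + s • Pi.single k 1) (by
      rw [Set.mem_Ici]
      intro j
      simp only [Pi.add_apply, Pi.smul_apply, smul_eq_mul]
      have : (0:ℝ) ≤ (Pi.single k (1:ℝ) : Fin m → ℝ) j := by
        rw [Pi.single_apply]; split_ifs <;> norm_num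
      nlinarith)
    rw [map_add, map_smul, hf (fun _ => θ)] at this
    change v < _ + s • l k at this
    have e : s * l k = -(∑ k, l k * θ - v) := by
      have : l k ≠ 0 := hneg.ne
      rw [show s = (∑ k, l k * θ - v) / (-l k) from rfl, div_neg, neg_mul, div_mul_cancel₀ _ this]
    rw [smul_eq_mul, e] at this
    linarith
  let w : Fin N → ℝ := fun i => if 0 ≤ ∑ k, l k * X k i then 1 else -1
  have hw : f (T w) < u := by
    apply hf1
    refine ⟨w, ⟨fun i => ?_, fun i => ?_⟩, rfl⟩ <;> simp only [w] <;> split_ifs <;> norm_num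
  have e2 : f (T w) = ∑ i, |∑ k, l k * X k i| := by
    rw [hf]
    simp only [hT, Finset.mul_sum]
    rw [Finset.sum_comm]
    apply Finset.sum_congr rfl
    intro i _
    have : ∑ k, l k * (X k i * w i) = (∑ k, l k * X k i) * w i := by
      rw [Finset.sum_mul]; apply Finset.sum_congr rfl; intros; ring
    rw [this]
    simp only [w]
    split_ifs with h0
    · rw [abs_of_nonneg h0, mul_one]
    · rw [abs_of_neg (by linarith)]; ring
  have := h l hl
  rw [← e2] at this
  rw [← Finset.sum_mul] at hθ
  linarith

lemma l1_upper (m N : ℕ) (X : Fin m → Fin N → ℝ)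
    (G2 : ∀ y : Fin N → Bool, ∑ k, (lin (X k) y)^2 ≤ 10 * (N:ℝ)^2) (μ : Fin m → ℝ) :
    ∑ i, |∑ k, μ k * X k i| ≤ 4 * N * Real.sqrt (∑ k, (μ k)^2) := by
  let y : Fin N → Bool := fun i => decide (0 ≤ ∑ k, μ k * X k i)
  have e2 : ∑ i, |∑ k, μ k * X k i| = ∑ k, μ k * lin (X k) y := by
    simp only [lin, Finset.mul_sum]
    rw [Finset.sum_comm]
    apply Finset.sum_congr rfl
    intro i _
    have : ∑ k, μ k * (X k i * pmVal (y i)) = (∑ k, μ k * X k i) * pmVal (y i) := by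
      rw [Finset.sum_mul]; apply Finset.sum_congr rfl; intros; ring
    rw [this]
    by_cases h0 : 0 ≤ ∑ k, μ k * X k i
    · rw [abs_of_nonneg h0]; simp [y, h0, pmVal]
    · rw [abs_of_neg (by linarith)]; simp [y, h0, pmVal]
  rw [e2]
  refine (Real.sum_mul_le_sqrt_mul_sqrt _ _ _).trans ?_
  rw [mul_comm]
  gcongr
  apply Real.sqrt_le_iff.mpr
  refine ⟨by positivity, (G2 y).trans ?_⟩
  nlinarith [sq_nonneg (N:ℝ)]

lemma l1_lower0 (m N : ℕ) (X : Fin m → Fin N → ℝ) (hm : 1 ≤ m)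
    (G2 : ∀ y : Fin N → Bool, ∑ k, (lin (X k) y)^2 ≤ 10 * (N:ℝ)^2)
    (G1 : ∀ n : Fin m → ℤ, (∑ k, (n k)^2 ≤ 8193 * m) → n ≠ 0 →
      (N:ℝ)/8 * Real.sqrt (∑ k, (n k : ℝ)^2) ≤ ∑ i, |∑ k, (n k : ℝ) * X k i|)
    (μ : Fin m → ℝ) (hμ : ∑ k, (μ k)^2 = 4096 * m) :
    2 * N * Real.sqrt m ≤ ∑ i, |∑ k, μ k * X k i| := by
  have hm0 : (0:ℝ) < m := by exact_mod_cast hm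
  let n : Fin m → ℤ := fun k => round (μ k)
  let ν : Fin m → ℝ := fun k => μ k - n k
  have hν : ∑ k, (ν k)^2 ≤ m / 4 := by
    calc _ ≤ ∑ k : Fin m, (1/4:ℝ) := by
          apply Finset.sum_le_sum; intro k _
          have := abs_sub_round (μ k)
          rw [← sq_abs]
          have h0 := abs_nonneg (ν k)
          have : |ν k| ≤ 1/2 := this
          nlinarith
      _ = _ := by simp; ring
  have h1 : ∑ k, (n k : ℝ)^2 ≤ 8193 * m := by
    calc _ ≤ ∑ k, (2 * (μ k)^2 + 2 * (ν k)^2) := by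
          apply Finset.sum_le_sum; intro k _
          simp only [ν]
          nlinarith [sq_nonneg (2 * μ k - n k)]
      _ ≤ _ := by rw [Finset.sum_add_distrib, ← Finset.mul_sum, ← Finset.mul_sum, hμ]; linarith
  have h2 : 2025 * m ≤ ∑ k, (n k : ℝ)^2 := by
    have : ∑ k, (μ k)^2 ≤ ∑ k, (2 * (n k:ℝ)^2 + 2 * (ν k)^2) := by
      apply Finset.sum_le_sum; intro k _
      simp only [ν]
      nlinarith [sq_nonneg (2 * n k - μ k)]
    rw [Finset.sum_add_distrib, ← Finset.mul_sum, ← Finset.mul_sum, hμ] at this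
    linarith
  have hn0 : n ≠ 0 := by
    intro h0
    rw [h0] at h2
    simp at h2
    linarith
  have g := G1 n (by exact_mod_cast h1) hn0
  have hs : 45 * Real.sqrt m ≤ Real.sqrt (∑ k, (n k : ℝ)^2) := by
    apply Real.le_sqrt_of_sq_le
    rw [mul_pow, Real.sq_sqrt hm0.le]; linarith
  have u := l1_upper m N X G2 ν
  have hs2 : Real.sqrt (∑ k, (ν k)^2) ≤ Real.sqrt m / 2 := by
    apply Real.sqrt_le_iff.mpr
    refine ⟨by positivity, ?_⟩
    rw [div_pow, Real.sq_sqrt hm0.le]; linarith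
  have tri : ∑ i, |∑ k, (n k : ℝ) * X k i| ≤ ∑ i, |∑ k, μ k * X k i| + ∑ i, |∑ k, ν k * X k i| := by
    rw [← Finset.sum_add_distrib]
    apply Finset.sum_le_sum
    intro i _
    have : ∑ k, (n k : ℝ) * X k i = ∑ k, μ k * X k i - ∑ k, ν k * X k i := by
      rw [← Finset.sum_sub_distrib]; apply Finset.sum_congr rfl; intro k _; simp only [ν]; ring
    rw [this]; exact abs_sub _ _
  have hN : (0:ℝ) ≤ N := Nat.cast_nonneg N
  have a1 : (N:ℝ)/8 * (45 * Real.sqrt m) ≤ (N:ℝ)/8 * Real.sqrt (∑ k, (n k : ℝ)^2) := by gcongr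
  have a2 : 4 * N * Real.sqrt (∑ k, (ν k)^2) ≤ 4 * N * (Real.sqrt m / 2) := by gcongr
  have a3 : 0 ≤ N * Real.sqrt m := by positivity
  nlinarith

lemma l1_lower (m N : ℕ) (X : Fin m → Fin N → ℝ) (hm : 1 ≤ m)
    (G2 : ∀ y : Fin N → Bool, ∑ k, (lin (X k) y)^2 ≤ 10 * (N:ℝ)^2)
    (G1 : ∀ n : Fin m → ℤ, (∑ k, (n k)^2 ≤ 8193 * m) → n ≠ 0 →
      (N:ℝ)/8 * Real.sqrt (∑ k, (n k : ℝ)^2) ≤ ∑ i, |∑ k, (n k : ℝ) * X k i|)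
    (l : Fin m → ℝ) :
    N / 32 * Real.sqrt (∑ k, (l k)^2) ≤ ∑ i, |∑ k, l k * X k i| := by
  have hm0 : (0:ℝ) < m := by exact_mod_cast hm
  have hT0 : 0 ≤ ∑ k, (l k)^2 := Finset.sum_nonneg fun k _ => sq_nonneg _
  set T := ∑ k, (l k)^2 with hT
  rcases hT0.eq_or_lt with h0 | hTpos
  · rw [← h0]; simp; exact Finset.sum_nonneg fun i _ => abs_nonneg _
  set q := Real.sqrt T with hq
  set p := Real.sqrt m with hp
  have hq0 : 0 < q := Real.sqrt_pos.mpr hTpos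
  have hp0 : 0 < p := Real.sqrt_pos.mpr hm0
  have hq2 : q^2 = T := Real.sq_sqrt hT0
  have hp2 : p^2 = m := Real.sq_sqrt hm0.le
  set s := q / (64 * p) with hs
  have hs0 : 0 < s := by positivity
  have h := l1_lower0 m N X hm G2 G1 (fun k => l k / s) (by
    simp only [div_pow]
    rw [← Finset.sum_div, ← hT, ← hq2, ← hp2, hs]
    field_simp; norm_num)
  have e : ∑ i, |∑ k, l k / s * X k i| = (∑ i, |∑ k, l k * X k i|) / s := by
    rw [Finset.sum_div]
    apply Finset.sum_congr rfl
    intro i _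
    rw [← abs_of_pos hs0, ← abs_div, abs_of_pos hs0, Finset.sum_div]
    congr 1; apply Finset.sum_congr rfl; intros; ring
  rw [e, le_div_iff₀ hs0, ← hp] at h
  refine le_trans (le_of_eq ?_) h
  rw [hs]; field_simp; ring

lemma good_det (κ : ℝ) (m N : ℕ) (x : Fin m → Cube N) (hm : 1 ≤ m) (hN : 1 ≤ N)
    (hmN : (32 * (|κ| + 641))^2 * m ≤ N)
    (G2 : ∀ y : Fin N → Bool, ∑ k, (lin (fun i => pmVal (x k i)) y)^2 ≤ 10 * (N:ℝ)^2)
    (G1 : ∀ n : Fin m → ℤ, (∑ k, (n k)^2 ≤ 8193 * m) → n ≠ 0 →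
      (N:ℝ)/8 * Real.sqrt (∑ k, (n k : ℝ)^2) ≤ ∑ i, |∑ k, (n k : ℝ) * pmVal (x k i)|) :
    ∃ y : Cube N, ∀ k, κ * Real.sqrt N ≤ cubeDot (x k) y := by
  have hm0 : (0:ℝ) < m := by exact_mod_cast hm
  have hN0 : (0:ℝ) < N := by exact_mod_cast hN
  have hκ := abs_nonneg κ
  have hmN' : m ≤ N := by
    have : (m:ℝ) ≤ N := by
      refine le_trans ?_ hmN
      have : (1:ℝ) ≤ (32 * (|κ| + 641))^2 := one_le_pow₀ (by linarith)
      nlinarith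
    exact_mod_cast this
  set p := Real.sqrt m with hp
  set q := Real.sqrt N with hq
  have hq0 : 0 < q := Real.sqrt_pos.mpr hN0
  have hp0 : 0 < p := Real.sqrt_pos.mpr hm0
  have hq2 : q^2 = N := Real.sq_sqrt hN0.le
  have hp2 : p^2 = m := Real.sq_sqrt hm0.le
  have hpq : 32 * (|κ| + 641) * p ≤ q := by
    apply le_of_pow_le_pow_left₀ (n := 2) (by norm_num) hq0.le
    rw [mul_pow, hp2, hq2]; exact hmN
  obtain ⟨w, hw, hk⟩ := minimax m N (fun k i => pmVal (x k i)) ((|κ| + 641) * q) (by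
    intro l hl
    refine le_trans ?_ (l1_lower m N (fun k i => pmVal (x k i)) hm G2 G1 l)
    have cs : ∑ k, l k ≤ p * Real.sqrt (∑ k, (l k)^2) := by
      have := Real.sum_mul_le_sqrt_mul_sqrt Finset.univ (fun _ : Fin m => (1:ℝ)) l
      simpa using this
    set L := Real.sqrt (∑ k, (l k)^2)
    have hL : 0 ≤ L := Real.sqrt_nonneg _
    calc (|κ| + 641) * q * ∑ k, l k ≤ (|κ| + 641) * q * (p * L) := by gcongr
      _ = (32 * (|κ| + 641) * p) * q * L / 32 := by ring
      _ ≤ q * q * L / 32 := by gcongr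
      _ = N / 32 * L := by rw [← hq2]; ring)
  obtain ⟨y, hy⟩ := lin_round N m hN hmN' (fun k i => pmVal (x k i))
    (fun k i => (pmVal_abs _).le) w hw
  refine ⟨y, fun k => ?_⟩
  have h1 := hk k
  have h2 := (abs_le.mp (hy k)).2
  have e : ∑ i, pmVal (x k i) * (w i - pmVal (y i)) = ∑ i, pmVal (x k i) * w i - cubeDot (x k) y := by
    simp only [cubeDot]
    rw [← Finset.sum_sub_distrib]; apply Finset.sum_congr rfl; intros; ring
  rw [e] at h2
  have := le_abs_self κ
  rw [← hq] at h2
  nlinarith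

lemma exp_neg_quad (t : ℝ) (ht : 0 ≤ t) : Real.exp (-t) ≤ 1 - t + t^2/2 := by
  have h := Real.quadratic_le_exp_of_nonneg ht
  have hp := Real.exp_pos t
  rw [Real.exp_neg, inv_le_iff_one_le_mul₀ hp]
  have h0 : 0 ≤ 1 - t + t^2/2 := by nlinarith [sq_nonneg (t-1)]
  calc (1:ℝ) ≤ (1 - t + t^2/2) * (1 + t + t^2/2) := by nlinarith [sq_nonneg (t^2)]
    _ ≤ _ := by gcongr

lemma col_lap (m : ℕ) (c : Fin m → ℝ) (σ : ℝ) (hσ : 0 < σ) (hc : σ^2 = ∑ k, (c k)^2) :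
    ∑ χ, Real.exp (-(|lin c χ| / (2*σ))) ≤ 2^m * Real.exp (-(1/8)) := by
  have key : ∀ χ, Real.exp (-(|lin c χ| / (2*σ))) ≤
      1 - 3/8/σ^2 * (lin c χ)^2 + 1/12/σ^4 * (lin c χ)^4 := by
    intro χ
    set u := |lin c χ| / σ with hu
    have hu0 : 0 ≤ u := by positivity
    have e1 : |lin c χ| / (2*σ) = u/2 := by rw [hu]; field_simp
    have e2 : 3/8/σ^2 * (lin c χ)^2 = 3/8*u^2 := by rw [hu, div_pow, sq_abs]; ring
    have e3 : 1/12/σ^4 * (lin c χ)^4 = 1/12*u^4 := by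
      rw [hu, div_pow, show |lin c χ|^4 = (|lin c χ|^2)^2 by ring, sq_abs]; ring
    rw [e1, e2, e3]
    refine (exp_neg_quad (u/2) (by positivity)).trans ?_
    have h1 : u - u^3/6 ≤ 1 := by
      nlinarith [mul_nonneg hu0 (sq_nonneg (u - 3/2)), sq_nonneg (u-3/2), sq_nonneg (u - 1)]
    have h2 : u^2 - u^4/6 ≤ u := by nlinarith
    nlinarith
  have hm2 := mom2 m c
  have hm4 := mom4 m c
  rw [← hc] at hm2 hm4
  calc _ ≤ ∑ χ, (1 - 3/8/σ^2 * (lin c χ)^2 + 1/12/σ^4 * (lin c χ)^4) :=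
        Finset.sum_le_sum fun χ _ => key χ
    _ = 2^m - 3/8/σ^2 * ∑ χ, (lin c χ)^2 + 1/12/σ^4 * ∑ χ, (lin c χ)^4 := by
        rw [Finset.sum_add_distrib, Finset.sum_sub_distrib, ← Finset.mul_sum, ← Finset.mul_sum]
        simp
    _ ≤ 2^m - 3/8/σ^2 * (2^m * σ^2) + 1/12/σ^4 * (2^m * (3 * (σ^2)^2)) := by
        rw [hm2]; gcongr
    _ = 2^m * (7/8) := by field_simp; ring
    _ ≤ _ := by
        gcongr
        have := Real.add_one_le_exp (-(1/8:ℝ))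
        linarith

lemma card_le_sum {α : Type} [Fintype α] (P : α → Prop) [DecidablePred P] (f : α → ℝ) (hf : ∀ a, 0 ≤ f a)
    (h : ∀ a, P a → 1 ≤ f a) : ((Finset.univ.filter P).card : ℝ) ≤ ∑ a, f a := by
  calc ((Finset.univ.filter P).card : ℝ) = ∑ a ∈ Finset.univ.filter P, (1:ℝ) := by simp
    _ ≤ ∑ a ∈ Finset.univ.filter P, f a := Finset.sum_le_sum fun a ha => h a (Finset.mem_filter.mp ha).2
    _ ≤ _ := Finset.sum_le_sum_of_subset_of_nonneg (Finset.subset_univ _) (fun a _ _ => hf a)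

lemma card_exists_le {α β : Type} [Fintype α] (S : Finset β) (P : β → α → Prop) (Q : α → Prop)
    [∀ b, DecidablePred (P b)] [DecidablePred Q]
    (hQ : ∀ a, Q a → ∃ b ∈ S, P b a) (C : ℝ)
    (h : ∀ b ∈ S, ((Finset.univ.filter (P b)).card : ℝ) ≤ C) :
    ((Finset.univ.filter Q).card : ℝ) ≤ S.card * C := by
  have h1 : Finset.univ.filter Q ⊆ S.biUnion fun b => Finset.univ.filter (P b) := by
    intro a ha
    obtain ⟨b, hb, hp⟩ := hQ a (Finset.mem_filter.mp ha).2
    exact Finset.mem_biUnion.mpr ⟨b, hb, by simp [hp]⟩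
  have h2 := (Finset.card_le_card h1).trans Finset.card_biUnion_le
  calc ((Finset.univ.filter Q).card : ℝ) ≤ ((∑ b ∈ S, (Finset.univ.filter (P b)).card : ℕ) : ℝ) := by
        exact_mod_cast h2
    _ = ∑ b ∈ S, ((Finset.univ.filter (P b)).card : ℝ) := by push_cast; rfl
    _ ≤ ∑ b ∈ S, C := Finset.sum_le_sum h
    _ = _ := by simp

lemma bad2 (m N : ℕ) (hN : 1 ≤ N) (hm : m ≤ N) :
    ((Finset.univ.filter fun x : Fin m → Cube N =>
      ¬ ∀ y : Fin N → Bool, ∑ k, (lin (fun i => pmVal (x k i)) y)^2 ≤ 10 * (N:ℝ)^2).card : ℝ)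
      ≤ (2^N)^m * Real.exp (-N) := by
  have hN0 : (0:ℝ) < N := by exact_mod_cast hN
  have hmr : (m:ℝ) ≤ N := by exact_mod_cast hm
  have fixed : ∀ y ∈ (Finset.univ : Finset (Fin N → Bool)),
      ((Finset.univ.filter fun x : Fin m → Cube N =>
      10 * (N:ℝ)^2 < ∑ k, (lin (fun i => pmVal (x k i)) y)^2).card : ℝ)
      ≤ (2^N)^m * Real.exp (-(2*N)) := by
    intro y _
    refine (card_le_sum _ (fun x => Real.exp (-(5/2*N)) *
      ∏ k, Real.exp ((lin (fun i => pmVal (y i)) (x k))^2/(4*N))) (fun x => by positivity) ?_).trans ?_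
    · intro x hx
      rw [← Real.exp_sum, ← Real.exp_add]
      apply Real.one_le_exp
      rw [← Finset.sum_div]
      have e : ∀ k, lin (fun i => pmVal (x k i)) y = lin (fun i => pmVal (y i)) (x k) := by
        intro k; simp only [lin, mul_comm]
      simp only [e] at hx
      have : 5/2*(N:ℝ) ≤ (∑ k, (lin (fun i => pmVal (y i)) (x k))^2)/(4*N) := by
        rw [le_div_iff₀ (by positivity)]; nlinarith
      linarith
    · rw [← Finset.mul_sum, ← Fintype.sum_pow (fun z => Real.exp ((lin (fun i => pmVal (y i)) z)^2/(4*N))) m]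
      have h := expsq N (4*N) (by linarith) (fun i => pmVal (y i)) (fun i => by rw [sq, pmVal_sq])
      have e : (N:ℝ)/(4*N-2*N) = 1/2 := by field_simp; ring
      rw [e] at h
      calc _ ≤ Real.exp (-(5/2*N)) * (2^N * Real.exp (1/2))^m := by gcongr
        _ = (2^N)^m * Real.exp (-(5/2*N) + m * (1/2)) := by
            rw [mul_pow, ← Real.exp_nat_mul, Real.exp_add]; ring
        _ ≤ _ := by gcongr; linarith
  refine (card_exists_le (Finset.univ : Finset (Fin N → Bool))
    (fun y (x : Fin m → Cube N) => 10 * (N:ℝ)^2 < ∑ k, (lin (fun i => pmVal (x k i)) y)^2)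
    (fun x : Fin m → Cube N =>
      ¬ ∀ y : Fin N → Bool, ∑ k, (lin (fun i => pmVal (x k i)) y)^2 ≤ 10 * (N:ℝ)^2) ?_ _ fixed).trans ?_
  · intro x hx
    push Not at hx
    obtain ⟨y, hy⟩ := hx
    exact ⟨y, Finset.mem_univ _, hy⟩
  · have : (((Finset.univ : Finset (Fin N → Bool)).card : ℕ) : ℝ) ≤ Real.exp N := by
      rw [Finset.card_univ]; simp
      rw [← Real.exp_one_pow]
      gcongr
      have := Real.add_one_le_exp (1:ℝ); linarith
    calc _ ≤ Real.exp N * ((2^N)^m * Real.exp (-(2*N))) := by gcongr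
      _ = (2^N)^m * Real.exp (N + -(2*N)) := by rw [Real.exp_add]; ring
      _ = _ := by congr 2; ring

lemma net_card (m : ℕ) (B : ℕ) :
    (((Fintype.piFinset fun _ : Fin m => Finset.Icc (-(B:ℤ)) B).filter
      fun n : Fin m → ℤ => ∑ k, (n k)^2 ≤ (B:ℤ)).card : ℝ) ≤ 2^B * 3^m := by
  set S := Fintype.piFinset fun _ : Fin m => Finset.Icc (-(B:ℤ)) B
  calc ((S.filter fun n : Fin m → ℤ => ∑ k, (n k)^2 ≤ (B:ℤ)).card : ℝ)
      = ∑ n ∈ S.filter (fun n : Fin m → ℤ => ∑ k, (n k)^2 ≤ (B:ℤ)), (1:ℝ) := by simp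
    _ ≤ ∑ n ∈ S.filter (fun n : Fin m → ℤ => ∑ k, (n k)^2 ≤ (B:ℤ)), 2^B * ∏ k, (1/2:ℝ)^(n k).natAbs := by
        apply Finset.sum_le_sum
        intro n hn
        have h := (Finset.mem_filter.mp hn).2
        have h1 : ∑ k, (n k).natAbs ≤ B := by
          have : ∑ k, ((n k).natAbs : ℤ) ≤ ∑ k, (n k)^2 := by
            apply Finset.sum_le_sum; intro k _
            rw [← Int.natAbs_sq]
            exact_mod_cast Nat.le_self_pow (by norm_num) _
          have h2 := this.trans h
          exact_mod_cast h2
        rw [Finset.prod_pow_eq_pow_sum]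
        calc (1:ℝ) = 2^B * (1/2)^B := by rw [← mul_pow]; norm_num
          _ ≤ _ := by
            gcongr 2^B * ?_
            exact pow_le_pow_of_le_one (by norm_num) (by norm_num) h1
    _ ≤ ∑ n ∈ S, 2^B * ∏ k, (1/2:ℝ)^(n k).natAbs :=
        Finset.sum_le_sum_of_subset_of_nonneg (Finset.filter_subset _ _) (fun _ _ _ => by positivity)
    _ = 2^B * ∏ k : Fin m, ∑ s ∈ Finset.Icc (-(B:ℤ)) B, (1/2:ℝ)^s.natAbs := by
        rw [← Finset.mul_sum, Finset.prod_univ_sum]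
    _ ≤ 2^B * ∏ k : Fin m, 3 := by
        gcongr with k
        refine (geom_int (1/2) (by norm_num) le_rfl _).trans (by norm_num)
    _ = _ := by simp

lemma bad1_fixed (m N : ℕ) (n : Fin m → ℤ) (hn : n ≠ 0) :
    ((Finset.univ.filter fun x : Fin m → Cube N =>
      ∑ i, |∑ k, (n k : ℝ) * pmVal (x k i)| < (N:ℝ)/8 * Real.sqrt (∑ k, (n k : ℝ)^2)).card : ℝ)
      ≤ (2^N)^m * Real.exp (-(N/16)) := by
  have hpos : 0 < ∑ k, (n k : ℝ)^2 := by
    obtain ⟨k, hk⟩ := Function.ne_iff.mp hn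
    apply Finset.sum_pos' (fun _ _ => sq_nonneg _)
    refine ⟨k, Finset.mem_univ _, ?_⟩
    have : (n k : ℝ) ≠ 0 := by exact_mod_cast hk
    positivity
  set σ := Real.sqrt (∑ k, (n k : ℝ)^2) with hσ
  have hσ0 : 0 < σ := Real.sqrt_pos.mpr hpos
  have hσ2 : σ^2 = ∑ k, (n k : ℝ)^2 := Real.sq_sqrt hpos.le
  let c : Fin m → ℝ := fun k => n k
  refine (card_le_sum _ (fun x => Real.exp (N/16) *
      ∏ i, Real.exp (-(|lin c (fun k => x k i)| / (2*σ)))) (fun x => by positivity) ?_).trans ?_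
  · intro x hx
    rw [← Real.exp_sum, ← Real.exp_add]
    apply Real.one_le_exp
    rw [Finset.sum_neg_distrib, ← Finset.sum_div]
    have : (∑ i, |lin c (fun k => x k i)|) / (2*σ) ≤ N/16 := by
      rw [div_le_iff₀ (by positivity)]
      simp only [lin, c]
      linarith
    linarith
  · rw [← Finset.mul_sum]
    have e : ∑ x : Fin m → Cube N, ∏ i, Real.exp (-(|lin c (fun k => x k i)| / (2*σ)))
        = ∑ z : Fin N → Fin m → Bool, ∏ i, Real.exp (-(|lin c (z i)| / (2*σ))) :=
      Fintype.sum_equiv (Equiv.piComm fun _ _ => Bool) _ _ (fun x => rfl)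
    rw [e, ← Fintype.sum_pow (fun z => Real.exp (-(|lin c z| / (2*σ)))) N]
    have h := col_lap m c σ hσ0 hσ2
    calc _ ≤ Real.exp (N/16) * (2^m * Real.exp (-(1/8)))^N := by
          have : 0 ≤ ∑ z, Real.exp (-(|lin c z| / (2*σ))) := by positivity
          gcongr
      _ = (2^N)^m * Real.exp (N/16 + N * (-(1/8))) := by
          rw [mul_pow, ← Real.exp_nat_mul, Real.exp_add, ← pow_mul, ← pow_mul, mul_comm m N]; ring
      _ = _ := by congr 2; ring

lemma bad1 (m N : ℕ) (hm : 262240 * m ≤ N) :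
    ((Finset.univ.filter fun x : Fin m → Cube N =>
      ¬ ∀ n : Fin m → ℤ, (∑ k, (n k)^2 ≤ 8193 * m) → n ≠ 0 →
      (N:ℝ)/8 * Real.sqrt (∑ k, (n k : ℝ)^2) ≤ ∑ i, |∑ k, (n k : ℝ) * pmVal (x k i)|).card : ℝ)
      ≤ (2^N)^m * Real.exp (-(N/32)) := by
  have hmr : (262240:ℝ) * m ≤ N := by exact_mod_cast hm
  set S := ((Fintype.piFinset fun _ : Fin m => Finset.Icc (-((8193*m : ℕ):ℤ)) ((8193*m : ℕ):ℤ)).filter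
      fun n : Fin m → ℤ => ∑ k, (n k)^2 ≤ ((8193*m : ℕ):ℤ)) with hS
  refine (card_exists_le (S.filter fun n => n ≠ 0)
    (fun n (x : Fin m → Cube N) =>
      ∑ i, |∑ k, (n k : ℝ) * pmVal (x k i)| < (N:ℝ)/8 * Real.sqrt (∑ k, (n k : ℝ)^2))
    (fun x : Fin m → Cube N =>
      ¬ ∀ n : Fin m → ℤ, (∑ k, (n k)^2 ≤ 8193 * m) → n ≠ 0 →
      (N:ℝ)/8 * Real.sqrt (∑ k, (n k : ℝ)^2) ≤ ∑ i, |∑ k, (n k : ℝ) * pmVal (x k i)|) ?_ _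
    (fun n hn => bad1_fixed m N n (Finset.mem_filter.mp hn).2)).trans ?_
  · intro x hx
    push Not at hx
    obtain ⟨n, h1, h2, h3⟩ := hx
    refine ⟨n, ?_, h3⟩
    rw [Finset.mem_filter, hS, Finset.mem_filter, Fintype.mem_piFinset]
    refine ⟨⟨fun k => ?_, by push_cast; exact h1⟩, h2⟩
    rw [Finset.mem_Icc]
    have : (n k)^2 ≤ ∑ k, (n k)^2 :=
      Finset.single_le_sum (f := fun k => (n k)^2) (fun _ _ => sq_nonneg _) (Finset.mem_univ k)
    push_cast
    constructor <;> nlinarith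
  · have hc : ((S.filter fun n => n ≠ 0).card : ℝ) ≤ Real.exp (8195 * m) := by
      calc ((S.filter fun n => n ≠ 0).card : ℝ) ≤ S.card := by
            exact_mod_cast Finset.card_le_card (Finset.filter_subset _ _)
        _ ≤ 2^(8193*m) * 3^m := net_card m (8193*m)
        _ ≤ 2^(8193*m) * (2^2)^m := by gcongr; norm_num
        _ = 2^(8195*m) := by rw [← pow_mul, ← pow_add]; congr 1; ring
        _ ≤ (Real.exp 1)^(8195*m) := by
            gcongr
            have := Real.add_one_le_exp (1:ℝ); linarith
        _ = _ := by rw [Real.exp_one_pow]; push_cast; rfl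
    calc _ ≤ Real.exp (8195 * m) * ((2^N)^m * Real.exp (-(N/16))) := by gcongr
      _ = (2^N)^m * Real.exp (8195 * m + -(N/16)) := by rw [Real.exp_add]; ring
      _ ≤ _ := by gcongr; linarith

lemma tuple_bound (κ : ℝ) (m N : ℕ) (hN : 1 ≤ N) (hmN : (32 * (|κ| + 641))^2 * m ≤ N) :
    ((Finset.univ.filter fun x : Fin m → Cube N =>
      ¬ ∃ y : Cube N, ∀ k, κ * Real.sqrt N ≤ cubeDot (x k) y).card : ℝ)
      ≤ (2^N)^m * (2 * Real.exp (-(N/32))) := by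
  have hN0 : (0:ℝ) < N := by exact_mod_cast hN
  rcases Nat.eq_zero_or_pos m with h0 | hm
  · subst h0
    have : (Finset.univ.filter fun x : Fin 0 → Cube N =>
      ¬ ∃ y : Cube N, ∀ k, κ * Real.sqrt N ≤ cubeDot (x k) y) = ∅ := by
      apply Finset.filter_eq_empty_iff.mpr
      intro x _ h
      exact h ⟨fun _ => true, fun k => k.elim0⟩
    rw [this]; simp; positivity
  have hκ := abs_nonneg κ
  have hm0 : (0:ℝ) < m := by exact_mod_cast hm
  have h1 : (262240:ℝ) * m ≤ N := by
    refine le_trans ?_ hmN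
    gcongr
    nlinarith
  have h1' : 262240 * m ≤ N := by exact_mod_cast h1
  have b1 := bad1 m N h1'
  have b2 := bad2 m N hN (by omega)
  have hsub : (Finset.univ.filter fun x : Fin m → Cube N =>
      ¬ ∃ y : Cube N, ∀ k, κ * Real.sqrt N ≤ cubeDot (x k) y) ⊆
      (Finset.univ.filter fun x : Fin m → Cube N =>
      ¬ ∀ n : Fin m → ℤ, (∑ k, (n k)^2 ≤ 8193 * m) → n ≠ 0 →
      (N:ℝ)/8 * Real.sqrt (∑ k, (n k : ℝ)^2) ≤ ∑ i, |∑ k, (n k : ℝ) * pmVal (x k i)|) ∪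
      (Finset.univ.filter fun x : Fin m → Cube N =>
      ¬ ∀ y : Fin N → Bool, ∑ k, (lin (fun i => pmVal (x k i)) y)^2 ≤ 10 * (N:ℝ)^2) := by
    intro x hx
    rw [Finset.mem_union, Finset.mem_filter, Finset.mem_filter]
    by_contra hcon
    simp only [Finset.mem_univ, true_and, not_or, not_not] at hcon
    exact (Finset.mem_filter.mp hx).2 (good_det κ m N x hm hN hmN hcon.2 hcon.1)
  have h2 := (Finset.card_le_card hsub).trans (Finset.card_union_le _ _)
  have h3 : Real.exp (-(N:ℝ)) ≤ Real.exp (-(N/32)) := by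
    apply Real.exp_le_exp.mpr; linarith
  have h4 : ((2:ℝ)^N)^m * Real.exp (-(N:ℝ)) ≤ (2^N)^m * Real.exp (-(N/32)) := by gcongr
  refine le_trans (by exact_mod_cast h2) (le_trans (add_le_add b1 b2) ?_)
  linarith

lemma anti_conc (κ t : ℝ) (ht : t = 4 * |κ| + 8) (N : ℕ) (hN : t^2 ≤ N) (y : Cube N) :
    (1/4 * Real.exp (-(3/2*t^2))) * 2^N ≤
      ((Finset.univ.filter fun x : Cube N => cubeDot x y < κ * Real.sqrt N).card : ℝ) := by
  have hκ := abs_nonneg κ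
  have ht0 : 0 < t := by linarith
  have hN0 : (0:ℝ) < N := lt_of_lt_of_le (by positivity) hN
  set s := Real.sqrt N with hs
  have hs0 : 0 < s := Real.sqrt_pos.mpr hN0
  have hs2 : s^2 = N := Real.sq_sqrt hN0.le
  set l := t / s with hl
  have hl0 : 0 < l := by positivity
  have hts : t ≤ s := by
    rw [hs]; exact Real.le_sqrt_of_sq_le hN
  have hl1 : l ≤ 1 := by rw [hl, div_le_one hs0]; exact hts
  have hl2 : N * l^2 = t^2 := by rw [hl, div_pow, hs2]; field_simp
  let c : Fin N → ℝ := fun i => - pmVal (y i)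
  have hc : ∀ i, (c i)^2 = 1 := by intro i; simp only [c]; rw [neg_sq, sq, pmVal_sq]
  have hlin : ∀ x, lin c x = - cubeDot x y := by
    intro x
    simp only [lin, c, cubeDot, ← Finset.sum_neg_distrib]
    exact Finset.sum_congr rfl fun i _ => by ring
  have m1 := exp_mgf N l c hc
  have m2 := exp_mgf N (2*l) c hc
  set M := (Real.cosh l)^N with hM
  have hM0 : Real.exp (t^2/4) ≤ M := by
    have h1 : Real.exp (l^2/4) ≤ Real.cosh l := by
      have h2 : 1 + l^2/2 ≤ Real.cosh l := by
        have h3 : l/2 ≤ Real.sinh (l/2) := Real.self_le_sinh_iff.mpr (by positivity)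
        have h4 := Real.cosh_two_mul (l/2)
        rw [Real.cosh_sq, show 2*(l/2) = l by ring] at h4
        rw [h4]
        nlinarith
      have h3 : Real.exp (l^2/4) ≤ 1 + l^2/2 := by
        have h4 : 1 - l^2/4 ≤ Real.exp (-(l^2/4)) := by
          have := Real.add_one_le_exp (-(l^2/4)); linarith
        rw [Real.exp_neg] at h4
        have hp := Real.exp_pos (l^2/4)
        have h5 : (1 - l^2/4) * Real.exp (l^2/4) ≤ 1 := by
          calc _ ≤ (Real.exp (l^2/4))⁻¹ * Real.exp (l^2/4) := by gcongr
            _ = 1 := inv_mul_cancel₀ hp.ne'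
        have h6 : l^2 ≤ 1 := by nlinarith
        have h7 : 1 ≤ (1 + l^2/2) * (1 - l^2/4) := by nlinarith [sq_nonneg l]
        have h8 : 0 < 1 - l^2/4 := by linarith
        by_contra h9
        push Not at h9
        nlinarith
      linarith
    calc Real.exp (t^2/4) = (Real.exp (l^2/4))^N := by
          rw [← Real.exp_nat_mul, ← hl2]; congr 1; ring
      _ ≤ _ := by rw [hM]; gcongr
  have hMp : 0 < M := (Real.exp_pos _).trans_le hM0
  have hV : (Real.cosh (2*l))^N ≤ Real.exp (2*t^2) := by
    calc _ ≤ (Real.exp ((2*l)^2/2))^N := by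
          gcongr
          exact Real.cosh_le_exp_half_sq _
      _ = _ := by rw [← Real.exp_nat_mul, ← hl2]; congr 1; ring
  let Z : Cube N → ℝ := fun x => Real.exp (l * lin c x)
  let G := Finset.univ.filter fun x : Cube N => M/2 < Z x
  have hG : (2^N * M / 2) ≤ ∑ x ∈ G, Z x := by
    have h1 := Finset.sum_filter_add_sum_filter_not Finset.univ (fun x : Cube N => M/2 < Z x) Z
    have h2 : ∑ x ∈ Finset.univ.filter (fun x : Cube N => ¬ M/2 < Z x), Z x ≤ 2^N * (M/2) := by
      calc _ ≤ ∑ x ∈ Finset.univ.filter (fun x : Cube N => ¬ M/2 < Z x), M/2 :=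
            Finset.sum_le_sum fun x hx => not_lt.mp (Finset.mem_filter.mp hx).2
        _ ≤ ∑ x : Cube N, M/2 :=
            Finset.sum_le_sum_of_subset_of_nonneg (Finset.filter_subset _ _)
              (fun _ _ _ => by positivity)
        _ = _ := by simp
    have h3 : ∑ x, Z x = 2^N * M := by
      simp only [Z]; rw [m1, mul_pow]
    have h4 : ∑ x ∈ G, Z x + ∑ x ∈ Finset.univ.filter (fun x : Cube N => ¬ M/2 < Z x), Z x
      = ∑ x, Z x := h1
    linarith
  have hCS : (∑ x ∈ G, Z x)^2 ≤ G.card * (2^N * Real.exp (2*t^2)) := by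
    refine (sq_sum_le_card_mul_sum_sq (s := G) (f := Z)).trans ?_
    gcongr
    calc ∑ x ∈ G, (Z x)^2 ≤ ∑ x, (Z x)^2 :=
          Finset.sum_le_sum_of_subset_of_nonneg (Finset.filter_subset _ _)
            (fun _ _ _ => by positivity)
      _ = ∑ x, Real.exp (2*l * lin c x) := by
          apply Finset.sum_congr rfl; intro x _
          simp only [Z]; rw [← Real.exp_nat_mul]; congr 1; push_cast; ring
      _ = 2^N * (Real.cosh (2*l))^N := by rw [m2, mul_pow]
      _ ≤ _ := by gcongr
  have hGc : (1/4 * Real.exp (-(3/2*t^2))) * 2^N ≤ G.card := by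
    have h1 : (2^N * Real.exp (t^2/4) / 2)^2 ≤ G.card * (2^N * Real.exp (2*t^2)) := by
      refine le_trans ?_ hCS
      have : 2^N * Real.exp (t^2/4) / 2 ≤ ∑ x ∈ G, Z x := le_trans (by gcongr) hG
      gcongr
    have h2 : (2^N * Real.exp (t^2/4) / 2)^2 =
        (1/4 * Real.exp (-(3/2*t^2))) * 2^N * (2^N * Real.exp (2*t^2)) := by
      have : Real.exp (t^2/4) ^ 2 = Real.exp (-(3/2*t^2)) * Real.exp (2*t^2) := by
        rw [← Real.exp_nat_mul, ← Real.exp_add]; congr 1; push_cast; ring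
      rw [div_pow, mul_pow, this]; ring
    rw [h2] at h1
    exact le_of_mul_le_mul_right h1 (by positivity)
  refine hGc.trans ?_
  have hsub : G ⊆ Finset.univ.filter fun x : Cube N => cubeDot x y < κ * s := by
    intro x hx
    have hx := (Finset.mem_filter.mp hx).2
    refine Finset.mem_filter.mpr ⟨Finset.mem_univ _, ?_⟩
    have h1 : Real.exp (t^2/4 - 1) < Real.exp (l * lin c x) := by
      refine lt_of_le_of_lt ?_ hx
      have h2 : (2:ℝ) ≤ Real.exp 1 := by have := Real.add_one_le_exp (1:ℝ); linarith
      rw [Real.exp_sub]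
      calc _ ≤ Real.exp (t^2/4) / 2 := by gcongr
        _ ≤ _ := by gcongr
    have h2 := Real.exp_lt_exp.mp h1
    rw [hlin, hl, div_mul_eq_mul_div, lt_div_iff₀ hs0] at h2
    have h3 : t * |κ| ≤ t^2/4 - 1 := by rw [ht]; nlinarith
    have h4 : t * (|κ| * s) < t * (- cubeDot x y) := by
      calc t * (|κ| * s) = (t * |κ|) * s := by ring
        _ ≤ (t^2/4-1) * s := by gcongr
        _ < _ := h2
    have h5 := lt_of_mul_lt_mul_left h4 ht0.le
    have h6 : -|κ| * s ≤ κ * s := by gcongr; exact neg_abs_le κ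
    linarith
  exact_mod_cast Finset.card_le_card hsub

lemma sum_prod_bool {X : Type} [Fintype X] [DecidableEq X] (f : X → Bool → ℝ) :
    ∑ ω : X → Bool, ∏ x, f x (ω x) = ∏ x, (f x true + f x false) := by
  have h := Finset.prod_univ_sum (fun _ : X => (Finset.univ : Finset Bool)) f
  rw [Fintype.piFinset_univ] at h
  rw [← h]
  exact Finset.prod_congr rfl fun x _ => by simp

lemma bWeight_prod {N : ℕ} (p : ℝ) (ω : Cube N → Bool) :
    bWeight p ω = ∏ x, (if ω x = true then p else 1 - p) := by
  rw [Finset.prod_ite, Finset.prod_const, Finset.prod_const, bWeight]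
  simp only [Bool.not_eq_true]

lemma bWeight_nonneg {N : ℕ} (p : ℝ) (h0 : 0 ≤ p) (h1 : p ≤ 1) (ω : Cube N → Bool) :
    0 ≤ bWeight p ω := by
  have : 0 ≤ 1 - p := by linarith
  unfold bWeight; positivity

lemma bWeight_sum {N : ℕ} (p : ℝ) : ∑ ω : Cube N → Bool, bWeight p ω = 1 := by
  simp only [bWeight_prod]
  rw [sum_prod_bool (fun _ b => if b = true then p else 1 - p)]
  simp

lemma mem_emptyInter {N : ℕ} (κ : ℝ) (ω : Cube N → Bool) :
    ω ∈ emptyInter κ ↔ ¬ ∃ y : Cube N, ∀ x, ω x = true → κ * Real.sqrt N ≤ cubeDot x y := by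
  simp only [emptyInter, Set.mem_ofPred_eq, Set.eq_empty_iff_forall_notMem, Set.mem_iInter,
    halfCube, ge_iff_le, not_exists]

lemma high_part (κ t : ℝ) (ht : t = 4 * |κ| + 8) (N : ℕ) (hN : t^2 ≤ N) (p : ℝ) (h0 : 0 ≤ p)
    (h1 : p ≤ 1) :
    1 - 2^N * Real.exp (-(p * ((1/4 * Real.exp (-(3/2*t^2))) * 2^N)))
      ≤ bernoulliP p (emptyInter (N := N) κ) := by
  have hq : 0 ≤ 1 - p := by linarith
  let B : Cube N → Finset (Cube N) := fun y =>
    Finset.univ.filter fun x : Cube N => cubeDot x y < κ * Real.sqrt N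
  let g : Cube N → Cube N → Bool → ℝ := fun y x b =>
    if b = true then (if x ∈ B y then 0 else p) else 1 - p
  have hg : ∀ y x b, 0 ≤ g y x b := by
    intro y x b; simp only [g]; split_ifs <;> linarith
  have hpt : ∀ ω : Cube N → Bool, bWeight p ω ≤
      (if ω ∈ emptyInter (N := N) κ then bWeight p ω else 0) + ∑ y, ∏ x, g y x (ω x) := by
    intro ω
    have hs : ∀ y, 0 ≤ ∏ x, g y x (ω x) := fun y => Finset.prod_nonneg fun x _ => hg y x _
    split_ifs with h
    · have := Finset.sum_nonneg fun y (_ : y ∈ Finset.univ) => hs y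
      linarith
    · rw [mem_emptyInter, not_not] at h
      obtain ⟨y, hy⟩ := h
      rw [zero_add]
      refine le_trans (le_of_eq ?_) (Finset.single_le_sum (fun y _ => hs y) (Finset.mem_univ y))
      rw [bWeight_prod]
      apply Finset.prod_congr rfl
      intro x _
      simp only [g]
      split_ifs with h2 h3
      · exact absurd (Finset.mem_filter.mp h3).2 (not_lt.mpr (hy x h2))
      · rfl
      · rfl
  have hsum : (1:ℝ) ≤ bernoulliP p (emptyInter (N := N) κ) +
      ∑ y, ∑ ω : Cube N → Bool, ∏ x, g y x (ω x) := by
    rw [← bWeight_sum (N := N) p, Finset.sum_comm, bernoulliP, ← Finset.sum_add_distrib]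
    exact Finset.sum_le_sum fun ω _ => hpt ω
  have hy : ∀ y, ∑ ω : Cube N → Bool, ∏ x, g y x (ω x) ≤
      Real.exp (-(p * ((1/4 * Real.exp (-(3/2*t^2))) * 2^N))) := by
    intro y
    rw [sum_prod_bool (g y)]
    have e : ∀ x, g y x true + g y x false = if x ∈ B y then 1 - p else 1 := by
      intro x
      by_cases hx : x ∈ B y
      · simp only [g, if_pos hx]; simp
      · simp only [g, if_neg hx]; simp
    simp only [e]
    rw [Finset.prod_ite, Finset.prod_const, Finset.prod_const_one, mul_one]
    have e2 : Finset.univ.filter (fun x => x ∈ B y) = B y := by simp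
    rw [e2]
    calc (1-p)^(B y).card ≤ (Real.exp (-p))^(B y).card := by
          gcongr; exact Real.one_sub_le_exp_neg p
      _ = Real.exp (-(p * (B y).card)) := by rw [← Real.exp_nat_mul]; congr 1; ring
      _ ≤ _ := by
          gcongr
          exact anti_conc κ t ht N hN y
  have : ∑ y : Cube N, ∑ ω : Cube N → Bool, ∏ x, g y x (ω x) ≤
      2^N * Real.exp (-(p * ((1/4 * Real.exp (-(3/2*t^2))) * 2^N))) := by
    refine (Finset.sum_le_sum fun y _ => hy y).trans (le_of_eq ?_)
    simp
  linarith

lemma card_fact (κ : ℝ) (N m : ℕ) :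
    (Finset.univ.filter fun ω : Cube N → Bool => ω ∈ emptyInter κ ∧
      (Finset.univ.filter fun x => ω x = true).card = m).card * m.factorial ≤
    (Finset.univ.filter fun x : Fin m → Cube N =>
      ¬ ∃ y : Cube N, ∀ k, κ * Real.sqrt N ≤ cubeDot (x k) y).card := by
  let A := {ω : Cube N → Bool // ω ∈ emptyInter κ ∧
      (Finset.univ.filter fun x => ω x = true).card = m}
  let T := {x : Fin m → Cube N // ¬ ∃ y : Cube N, ∀ k, κ * Real.sqrt N ≤ cubeDot (x k) y}
  have he : ∀ a : A, Nonempty (Fin m ≃ {x // a.1 x = true}) := by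
    intro a
    have : Fintype.card {x // a.1 x = true} = m := by
      rw [Fintype.card_subtype]; exact a.2.2
    exact ⟨(Fintype.equivFinOfCardEq this).symm⟩
  let e : ∀ a : A, Fin m ≃ {x // a.1 x = true} := fun a => (he a).some
  let F : A × Equiv.Perm (Fin m) → T := fun q =>
    ⟨fun k => (e q.1 (q.2 k)).1, by
      rintro ⟨y, hy⟩
      refine (mem_emptyInter κ q.1.1).mp q.1.2.1 ⟨y, fun x hx => ?_⟩
      have := hy (q.2.symm ((e q.1).symm ⟨x, hx⟩))
      simpa using this⟩
  have hr : ∀ q : A × Equiv.Perm (Fin m), ∀ x, q.1.1 x = true ↔ ∃ k, (F q).1 k = x := by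
    intro q x
    constructor
    · intro hx
      exact ⟨q.2.symm ((e q.1).symm ⟨x, hx⟩), by simp [F]⟩
    · rintro ⟨k, rfl⟩
      exact (e q.1 (q.2 k)).2
  have hF : Function.Injective F := by
    rintro ⟨a, σ⟩ ⟨b, τ⟩ h
    have hab : a = b := by
      apply Subtype.ext
      funext x
      have h1 := hr (a, σ) x
      have h2 := hr (b, τ) x
      rw [h] at h1
      exact Bool.eq_iff_iff.mpr (h1.trans h2.symm)
    subst hab
    congr 1
    ext1 k
    have h3 := congrFun (congrArg Subtype.val h) k
    exact (e a).injective (Subtype.ext h3)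
  have hcard := Fintype.card_le_of_injective F hF
  rw [Fintype.card_prod, Fintype.card_perm, Fintype.card_fin, Fintype.card_subtype,
    Fintype.card_subtype] at hcard
  exact hcard

lemma low_part (κ A : ℝ) (hA : A = (32 * (|κ| + 641))^2) (N : ℕ) (hN : 1 ≤ N) (a : ℝ)
    (ha : 0 ≤ a) (h1 : a / 2^N ≤ 1) :
    bernoulliP (a / 2^N) (emptyInter (N := N) κ) ≤
      2 * Real.exp (a - N/32) + Real.exp (3 * a - N/A) := by
  have hκ := abs_nonneg κ
  have hA0 : 0 < A := by rw [hA]; positivity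
  set p := a / 2^N with hp
  have hp0 : 0 ≤ p := by positivity
  let E : ℕ → ℕ := fun m => (Finset.univ.filter fun ω : Cube N → Bool => ω ∈ emptyInter κ ∧
      (Finset.univ.filter fun x => ω x = true).card = m).card
  have s1 : bernoulliP p (emptyInter (N := N) κ) ≤
      ∑ m ∈ Finset.range (2^N+1), p^m * E m := by
    have hb : ∀ ω : Cube N → Bool, (if ω ∈ emptyInter (N := N) κ then bWeight p ω else 0) ≤
        ∑ m ∈ Finset.range (2^N+1), if (ω ∈ emptyInter κ ∧
      (Finset.univ.filter fun x => ω x = true).card = m) then p^m else 0 := by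
      intro ω
      split_ifs with h
      · simp only [h, true_and]
        rw [Finset.sum_ite_eq, if_pos]
        · unfold bWeight
          apply mul_le_of_le_one_right (by positivity)
          exact pow_le_one₀ (by linarith) (by linarith)
        · rw [Finset.mem_range, Nat.lt_succ_iff]
          refine (Finset.card_le_univ _).trans ?_
          simp
      · exact Finset.sum_nonneg fun m _ => by split_ifs <;> positivity
    unfold bernoulliP
    refine (Finset.sum_le_sum fun ω _ => hb ω).trans (le_of_eq ?_)
    rw [Finset.sum_comm]
    apply Finset.sum_congr rfl
    intro m _
    rw [← Finset.sum_filter, Finset.sum_const, nsmul_eq_mul, mul_comm]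
  have s2 : ∀ m, p^m * E m ≤ a^m / m.factorial * (2 * Real.exp (-(N/32))) +
      (3*a)^m / m.factorial * Real.exp (-(N/A)) := by
    intro m
    have hf : (0:ℝ) < m.factorial := by exact_mod_cast m.factorial_pos
    set T := (Finset.univ.filter fun x : Fin m → Cube N =>
      ¬ ∃ y : Cube N, ∀ k, κ * Real.sqrt N ≤ cubeDot (x k) y).card with hT
    have hE : (E m : ℝ) * m.factorial ≤ T := by exact_mod_cast card_fact κ N m
    have hE2 : (E m : ℝ) ≤ T / m.factorial := by rw [le_div_iff₀ hf]; exact hE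
    have hpm : p^m * (2^N)^m = a^m := by rw [← mul_pow, hp]; congr 1; field_simp
    have hTb : (T:ℝ) ≤ (2^N)^m * (2 * Real.exp (-(N/32)) + 3^m * Real.exp (-(N/A))) := by
      by_cases hc : A * m ≤ N
      · have h := tuple_bound κ m N hN (by rw [← hA]; exact hc)
        refine le_trans h ?_
        gcongr
        have : 0 ≤ (3:ℝ)^m * Real.exp (-(N/A)) := by positivity
        linarith
      · push Not at hc
        have h3 : (T:ℝ) ≤ (2^N)^m := by
          have : T ≤ Fintype.card (Fin m → Cube N) := Finset.card_le_univ _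
          have h4 : Fintype.card (Fin m → Cube N) = (2^N)^m := by simp
          rw [h4] at this
          exact_mod_cast this
        have h5 : 1 ≤ (3:ℝ)^m * Real.exp (-(N/A)) := by
          have h6 : N/A ≤ m := by rw [div_le_iff₀ hA0]; linarith
          calc (1:ℝ) = Real.exp m * Real.exp (-m) := by rw [← Real.exp_add]; simp
            _ ≤ 3^m * Real.exp (-(N/A)) := by
              gcongr
              rw [← Real.exp_one_pow]
              gcongr
              have := Real.exp_one_lt_d9; linarith
        calc (T:ℝ) ≤ (2^N)^m * 1 := by simpa using h3
          _ ≤ _ := by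
            gcongr
            have := Real.exp_pos (-((N:ℝ)/32))
            linarith
    calc p^m * E m ≤ p^m * (((2^N)^m * (2 * Real.exp (-(N/32)) + 3^m * Real.exp (-(N/A))))
            / m.factorial) := by gcongr; exact hE2.trans (by gcongr)
      _ = (p^m * (2^N)^m) / m.factorial * (2 * Real.exp (-(N/32)) + 3^m * Real.exp (-(N/A))) := by
          ring
      _ = _ := by rw [hpm, mul_pow]; ring
  refine s1.trans ((Finset.sum_le_sum fun m _ => s2 m).trans ?_)
  rw [Finset.sum_add_distrib, ← Finset.sum_mul, ← Finset.sum_mul]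
  have e1 := Real.sum_le_exp_of_nonneg ha (2^N+1)
  have e2 := Real.sum_le_exp_of_nonneg (show 0 ≤ 3*a by positivity) (2^N+1)
  calc _ ≤ Real.exp a * (2 * Real.exp (-(N/32))) + Real.exp (3*a) * Real.exp (-(N/A)) := by
        gcongr
    _ = _ := by rw [sub_eq_add_neg, sub_eq_add_neg, Real.exp_add, Real.exp_add]; ring
/-- For every κ there are constants c, c₃, C₁ > 0 depending only on κ such that
for all sufficiently large N, the intersection ⋂_{x : ω_x = 1} H(x) is empty
with probability at most e^{-cN} when p = c₃ N 2^{-N}, and with probability at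
least 1 - e^{-cN} when p = C₁ N 2^{-N}. -/
theorem perceptron_crude_bounds (κ : ℝ) :
    ∃ c > (0 : ℝ), ∃ c₃ > (0 : ℝ), ∃ C₁ > (0 : ℝ), ∃ N₀ : ℕ, ∀ N : ℕ, N₀ ≤ N →
      bernoulliP (c₃ * N * (2 : ℝ) ^ (-(N : ℝ))) (emptyInter (N := N) κ) ≤
          Real.exp (-c * N) ∧
        bernoulliP (C₁ * N * (2 : ℝ) ^ (-(N : ℝ))) (emptyInter (N := N) κ) ≥
          1 - Real.exp (-c * N) := by
  have hκ := abs_nonneg κ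
  obtain ⟨A, hA⟩ : ∃ A : ℝ, A = (32 * (|κ| + 641))^2 := ⟨_, rfl⟩
  obtain ⟨t, ht⟩ : ∃ t : ℝ, t = 4 * |κ| + 8 := ⟨_, rfl⟩
  have hA1 : 32 ≤ A := by rw [hA]; nlinarith
  have hA0 : 0 < A := by linarith
  obtain ⟨δ, hδ⟩ : ∃ δ : ℝ, δ = 1/4 * Real.exp (-(3/2*t^2)) := ⟨_, rfl⟩
  have hδ0 : 0 < δ := by rw [hδ]; positivity
  have htend := tendsto_pow_const_div_const_pow_of_one_lt 1 (show (1:ℝ) < 2 by norm_num)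
  have hev := htend.eventually (gt_mem_nhds (show (0:ℝ) < δ/2 by positivity))
  obtain ⟨N₁, hN₁⟩ := Filter.eventually_atTop.mp hev
  refine ⟨1/(4*A), by positivity, 1/(6*A), by positivity, 2/δ, by positivity,
    max (max 1 N₁) (max ⌈8*A⌉₊ ⌈t^2⌉₊), ?_⟩
  intro N hN
  simp only [max_le_iff] at hN
  obtain ⟨⟨hN1, hN2⟩, hN3, hN4⟩ := hN
  have hN3 : 8*A ≤ N := Nat.ceil_le.mp hN3
  have hN4 : t^2 ≤ N := Nat.ceil_le.mp hN4
  have h5 := hN₁ N hN2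
  have hN0 : (0:ℝ) < N := by exact_mod_cast hN1
  have h2N : (0:ℝ) < 2^N := by positivity
  have hpow : (2:ℝ)^(-(N:ℝ)) = (2^N)⁻¹ := by
    rw [Real.rpow_neg (by norm_num), Real.rpow_natCast]
  rw [hpow, ← div_eq_mul_inv, ← div_eq_mul_inv]
  constructor
  · have hlow : 1/(6*A) * N / 2^N ≤ 1 := by
      rw [div_le_one h2N]
      have h6 : (N:ℝ) ≤ 2^N := by exact_mod_cast Nat.lt_two_pow_self.le
      have h7 : 1/(6*A) ≤ 1 := by rw [div_le_one (by positivity)]; linarith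
      nlinarith
    refine (low_part κ A hA N hN1 _ (by positivity) hlow).trans ?_
    have e1 : 3 * (1/(6*A) * N) - N/A = -(N/(2*A)) := by field_simp; ring
    have e2 : 1/(6*A) * N - N/32 ≤ -(N/(2*A)) := by
      have h8 : (N:ℝ)/A ≤ N/32 := by gcongr
      have h9 : 1/(6*A) * N + N/(2*A) = 2/3 * (N/A) := by field_simp; norm_num
      have h10 : 0 ≤ N/A := by positivity
      linarith
    rw [e1]
    have e3 : Real.exp (1/(6*A) * N - N/32) ≤ Real.exp (-(N/(2*A))) := Real.exp_le_exp.mpr e2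
    have e4 : (3:ℝ) ≤ Real.exp (N/(4*A)) := by
      have h8 : 2 ≤ N/(4*A) := by rw [le_div_iff₀ (by positivity)]; linarith
      have := Real.add_one_le_exp (N/(4*A)); linarith
    calc _ ≤ 3 * Real.exp (-(N/(2*A))) := by linarith
      _ ≤ Real.exp (N/(4*A)) * Real.exp (-(N/(2*A))) := by gcongr
      _ = _ := by rw [← Real.exp_add]; congr 1; field_simp; ring
  · have hhigh : 2/δ * N / 2^N ≤ 1 := by
      have h6 : 2/δ * N / 2^N = 2/δ * (N^1/2^N) := by ring
      rw [h6]
      calc 2/δ * ((N:ℝ)^1/2^N) ≤ 2/δ * (δ/2) := by gcongr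
        _ = 1 := by field_simp
    have h := high_part κ t ht N hN4 (2/δ * N / 2^N) (by positivity) hhigh
    refine le_trans ?_ h
    rw [← hδ]
    have e1 : 2/δ * N / 2^N * (δ * 2^N) = 2*N := by field_simp
    rw [e1]
    have e2 : (2:ℝ)^N ≤ Real.exp N := by
      rw [← Real.exp_one_pow]
      gcongr
      have := Real.add_one_le_exp (1:ℝ); linarith
    have e3 : (2:ℝ)^N * Real.exp (-(2*N)) ≤ Real.exp (-(1/(4*A)) * N) := by
      calc _ ≤ Real.exp N * Real.exp (-(2*N)) := by gcongr
        _ = Real.exp (-1 * N) := by rw [← Real.exp_add]; congr 1; ring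
        _ ≤ _ := by
          gcongr
          rw [div_le_one (by positivity)]; linarith
    linarith
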